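/- arXiv:1706.02643 — 6 statements merged into one kernel-verified Lean document; each statement's English description precedes it below -/
import Mathlib

section
/- Let U ⊆ ℝ² be an open connected set, f = (f₁, f₂) : U → ℝ² a C² map with det Df(z) ≠ 0 for every z ∈ U, and z₀ ∈ U a point with f(z₀) = (0,0). Let W be the period annulus of z₀, i.e., W ⊆ U is open and connected, z₀ ∈ W, every point of W \ {z₀} lies on a periodic solution of ∇H_f^⊥ whose image is contained in W, and W is maximal with these properties (any open connected W' with W ⊆ W' ⊆ U having the same properties equals W). Then f is injective on the closure of W in U (on cl(W) ∩ U), and f(W) = ℝ² or f(W) is an open disc centered at the origin (f(W) = {w ∈ ℝ² : ‖w‖ < r} for some r > 0). -/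
open Real Set

/-- Partial derivative in the `x` direction. -/
noncomputable def pdx (g : ℝ × ℝ → ℝ) (z : ℝ × ℝ) : ℝ := fderiv ℝ g z (1, 0)

/-- Partial derivative in the `y` direction. -/
noncomputable def pdy (g : ℝ × ℝ → ℝ) (z : ℝ × ℝ) : ℝ := fderiv ℝ g z (0, 1)

/-- The Hamiltonian `H_f = (f₁² + f₂²)/2`. -/
noncomputable def Ham (f : ℝ × ℝ → ℝ × ℝ) (z : ℝ × ℝ) : ℝ :=
  ((f z).1 ^ 2 + (f z).2 ^ 2) / 2

/-- The Hamiltonian vector field `∇H_f^⊥ = (−∂H_f/∂y, ∂H_f/∂x)`. -/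
noncomputable def hamVF (f : ℝ × ℝ → ℝ × ℝ) (z : ℝ × ℝ) : ℝ × ℝ :=
  (-(pdy (Ham f) z), pdx (Ham f) z)

/-- The Jacobian determinant `det Df = ∂f₁/∂x ∂f₂/∂y − ∂f₂/∂x ∂f₁/∂y`. -/
noncomputable def jacDet (f : ℝ × ℝ → ℝ × ℝ) (z : ℝ × ℝ) : ℝ :=
  pdx (fun w => (f w).1) z * pdy (fun w => (f w).2) z -
    pdx (fun w => (f w).2) z * pdy (fun w => (f w).1) z

/-- `γ` is a periodic solution of the vector field `X` whose image is contained in `S`: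
a non-constant `C¹` curve solving `γ' = X ∘ γ` with some period `T > 0`. -/
def IsPeriodicSolOn (X : ℝ × ℝ → ℝ × ℝ) (S : Set (ℝ × ℝ)) (γ : ℝ → ℝ × ℝ) : Prop :=
  (∀ t, γ t ∈ S) ∧ (∀ t, HasDerivAt γ (X (γ t)) t) ∧
    (∃ T > 0, ∀ t, γ (t + T) = γ t) ∧ ∃ t s, γ t ≠ γ s

/-- The Euclidean norm on `ℝ²`. -/
noncomputable def euclNorm (w : ℝ × ℝ) : ℝ := Real.sqrt (w.1 ^ 2 + w.2 ^ 2)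

/-- The open Euclidean disc of radius `r` centered at the origin. -/
def disc (r : ℝ) : Set (ℝ × ℝ) := {w | euclNorm w < r}

/-- `W` is the period annulus of the singular point `z₀` of the vector field `X` on `U`:
the maximal open connected subset of `U` containing `z₀` all whose points other than `z₀`
lie on periodic solutions of `X` contained in `W`. -/
def IsPeriodAnnulus (X : ℝ × ℝ → ℝ × ℝ) (U : Set (ℝ × ℝ)) (z₀ : ℝ × ℝ)
    (W : Set (ℝ × ℝ)) : Prop :=
  z₀ ∈ W ∧ W ⊆ U ∧ IsOpen W ∧ IsConnected W ∧
    (∀ z ∈ W \ {z₀}, ∃ γ, IsPeriodicSolOn X W γ ∧ γ 0 = z) ∧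
    ∀ W', z₀ ∈ W' → W' ⊆ U → IsOpen W' → IsConnected W' →
      (∀ z ∈ W' \ {z₀}, ∃ γ, IsPeriodicSolOn X W' γ ∧ γ 0 = z) → W ⊆ W' → W' = W

open Topology

section LocalHomeomorphSections

variable {E : Type*} [TopologicalSpace E] {p : E → ℂ}

/-- A section of a local homeomorphism over a convex set agrees near each limit point `y` of its
image with the local inverse at `y`. -/
lemma exists_symm_eqOn_section [T2Space E] (hp : IsLocalHomeomorph p) {D : Set ℂ}
    (hD : Convex ℝ D) {s : ℂ → E} (hs : ContinuousOn s D) (hps : ∀ w ∈ D, p (s w) = w) {y : E}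
    (hy : y ∈ closure (s '' D)) :
    ∃ e : OpenPartialHomeomorph E ℂ, ∃ ε > 0, p = e ∧ y ∈ e.source ∧
      Metric.ball (p y) ε ⊆ e.target ∧ EqOn e.symm s (Metric.ball (p y) ε ∩ D) := by
  obtain ⟨e, hye, he⟩ := hp y
  have hty : p y ∈ e.target := by rw [he]; exact e.map_source hye
  obtain ⟨ε, hε, hball⟩ := Metric.isOpen_iff.1 e.open_target (p y) hty
  refine ⟨e, ε, hε, he, hye, hball, ?_⟩
  have hN : e.source ∩ p ⁻¹' Metric.ball (p y) ε ∈ 𝓝 y :=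
    Filter.inter_mem (e.open_source.mem_nhds hye)
      (hp.continuous.continuousAt.preimage_mem_nhds (Metric.ball_mem_nhds _ hε))
  obtain ⟨_, ⟨hx₁, hx₂⟩, w, hw, rfl⟩ := mem_closure_iff_nhds.1 hy _ hN
  rw [mem_preimage, hps w hw] at hx₂
  refine (T2Space.isSeparatedMap p).eqOn_of_comp_eqOn hp.isLocallyInjective
    ((convex_ball _ _).inter hD).isPreconnected
    (e.continuousOn_symm.mono (inter_subset_left.trans hball)) (hs.mono inter_subset_right)
    ?_ ⟨hx₂, hw⟩ ?_
  · rintro v ⟨hv, hvD⟩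
    simp only [Function.comp_apply, hps v hvD]
    rw [he]
    exact e.right_inv (hball hv)
  · have h := e.left_inv hx₁
    rwa [← he, hps w hw] at h

lemma map_mem_closure_of_section (hp : Continuous p) {D : Set ℂ} {s : ℂ → E}
    (hps : ∀ w ∈ D, p (s w) = w) {y : E} (hy : y ∈ closure (s '' D)) : p y ∈ closure D :=
  map_mem_closure hp hy (by rintro _ ⟨w, hw, rfl⟩; rwa [hps w hw])

/-- A local homeomorphism is injective on the closure of the image of a section over a convex
set. -/
lemma injOn_closure_image_section [T2Space E] (hp : IsLocalHomeomorph p) {D : Set ℂ}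
    (hD : Convex ℝ D) {s : ℂ → E} (hs : ContinuousOn s D) (hps : ∀ w ∈ D, p (s w) = w) :
    InjOn p (closure (s '' D)) := by
  intro y₁ h₁ y₂ h₂ h
  have key : ∀ y ∈ closure (s '' D), Filter.Tendsto s (𝓝[D] (p y)) (𝓝 y) := by
    intro y hy
    obtain ⟨e, ε, hε, he, hye, hball, heq⟩ := exists_symm_eqOn_section hp hD hs hps hy
    have hc : Filter.Tendsto e.symm (𝓝[D] (p y)) (𝓝 y) := by
      have := e.continuousAt_symm (hball (Metric.mem_ball_self hε))
      rw [ContinuousAt, he, e.left_inv hye] at this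
      rw [he]
      exact this.mono_left nhdsWithin_le_nhds
    refine hc.congr' ?_
    filter_upwards [mem_nhdsWithin_of_mem_nhds (Metric.ball_mem_nhds (p y) hε),
      self_mem_nhdsWithin] with w hw hwD using heq ⟨hw, hwD⟩
  have : (𝓝[D] (p y₁)).NeBot :=
    mem_closure_iff_nhdsWithin_neBot.1 (map_mem_closure_of_section hp.continuous hps h₁)
  have h₂' := key y₂ h₂
  rw [← h] at h₂'
  exact tendsto_nhds_unique (key y₁ h₁) h₂'

/-- Near each limit point of the image of a section over a convex set `D`, local inverses over
`closure D` stay in the closure of that image. -/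
lemma symm_mem_closure_image_section {D : Set ℂ} {s : ℂ → E} {e : OpenPartialHomeomorph E ℂ}
    {c : ℂ} {ε : ℝ} (hball : Metric.ball c ε ⊆ e.target)
    (heq : EqOn e.symm s (Metric.ball c ε ∩ D)) {w : ℂ} (hw : w ∈ Metric.ball c ε)
    (hwD : w ∈ closure D) : e.symm w ∈ closure (s '' D) := by
  have hmem : w ∈ closure (Metric.ball c ε ∩ D) :=
    Metric.isOpen_ball.inter_closure ⟨hw, hwD⟩
  have hc : ContinuousAt e.symm w := e.continuousAt_symm (hball hw)
  refine closure_mono ?_ (hc.continuousWithinAt.mem_closure_image hmem)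
  rintro _ ⟨v, hv, rfl⟩
  exact ⟨v, hv.2, (heq hv).symm⟩

/-- A preconnected set lying over `closure D` and meeting the closure of the image of a section
over the convex set `D` is contained in it. -/
lemma subset_closure_image_section [T2Space E] (hp : IsLocalHomeomorph p) {D : Set ℂ}
    (hD : Convex ℝ D) {s : ℂ → E} (hs : ContinuousOn s D) (hps : ∀ w ∈ D, p (s w) = w)
    {C : Set E} (hC : IsPreconnected C) (hCD : ∀ x ∈ C, p x ∈ closure D) {y : E} (hyC : y ∈ C)
    (hy : y ∈ closure (s '' D)) : C ⊆ closure (s '' D) := by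
  set K := closure (s '' D) with hK
  have hsub : K ⊆ interior (K ∪ p ⁻¹' (closure D)ᶜ) := by
    intro x hx
    obtain ⟨e, ε, hε, he, hxe, hball, heq⟩ := exists_symm_eqOn_section hp hD hs hps hx
    rw [mem_interior_iff_mem_nhds]
    filter_upwards [e.open_source.mem_nhds hxe,
      hp.continuous.continuousAt.preimage_mem_nhds (Metric.ball_mem_nhds (p x) hε)] with z hz hzb
    by_cases hzD : p z ∈ closure D
    · left
      have h := symm_mem_closure_image_section hball heq hzb hzD
      rwa [he, e.left_inv hz] at h
    · exact Or.inr hzD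
  have hdisj : C ⊆ interior (K ∪ p ⁻¹' (closure D)ᶜ) ∨ C ⊆ Kᶜ := by
    refine isPreconnected_iff_subset_of_disjoint.1 hC _ _ isOpen_interior
      isClosed_closure.isOpen_compl ?_ ?_
    · intro x _
      by_cases hx : x ∈ K
      · exact Or.inl (hsub hx)
      · exact Or.inr hx
    · rw [eq_empty_iff_forall_notMem]
      rintro x ⟨hxC, hx, hxK⟩
      rcases interior_subset hx with h | h
      · exact hxK h
      · exact h (hCD x hxC)
  rcases hdisj with h | h
  · intro x hx
    exact (interior_subset (h hx)).resolve_right (fun hn => hn (hCD x hx))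
  · exact absurd hy (h hyC)

/-- `p` has a continuous section over the disc of radius `r` with values in `W` and value `z₀` at
the origin. -/
def HasDiscSection (p : E → ℂ) (W : Set E) (z₀ : E) (r : ℝ) : Prop :=
  ∃ s : ℂ → E, ContinuousOn s (Metric.ball 0 r) ∧ s 0 = z₀ ∧
    ∀ w ∈ Metric.ball 0 r, s w ∈ W ∧ p (s w) = w

lemma hasDiscSection_of_injOn (hp : IsLocalHomeomorph p) {W O : Set E} {z₀ : E} {r : ℝ}
    (hpz : p z₀ = 0) (hO : IsOpen O) (hOW : O ⊆ W) (hz₀ : z₀ ∈ O) (hinj : InjOn p O)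
    (hr : Metric.ball 0 r ⊆ p '' O) : HasDiscSection p W z₀ r := by
  have : Nonempty E := ⟨z₀⟩
  have hmem : ∀ w ∈ Metric.ball (0 : ℂ) r, Function.invFunOn p O w ∈ O ∧
      p (Function.invFunOn p O w) = w := fun w hw => Function.invFunOn_pos (hr hw)
  refine ⟨Function.invFunOn p O, ?_, ?_, fun w hw => ⟨hOW (hmem w hw).1, (hmem w hw).2⟩⟩
  · intro w hw
    refine ContinuousAt.continuousWithinAt ?_
    intro N hN
    have h1 : p '' (N ∩ O) ∈ 𝓝 w := by
      have := hp.isOpenMap.image_mem_nhds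
        (Filter.inter_mem hN (hO.mem_nhds (hmem w hw).1))
      rwa [(hmem w hw).2] at this
    rw [Filter.mem_map]
    filter_upwards [h1, Metric.isOpen_ball.mem_nhds hw] with v hv hvr
    obtain ⟨x, ⟨hxN, hxO⟩, rfl⟩ := hv
    rw [mem_preimage, hinj (hmem _ hvr).1 hxO (hmem _ hvr).2]
    exact hxN
  · have h0 : (0 : ℂ) ∈ p '' O := ⟨z₀, hz₀, hpz⟩
    exact hinj (Function.invFunOn_mem h0) hz₀ ((Function.invFunOn_eq h0).trans hpz.symm)

lemma exists_hasDiscSection (hp : IsLocalHomeomorph p) {W : Set E} {z₀ : E}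
    (hW : IsOpen W) (hz₀ : z₀ ∈ W) (hpz : p z₀ = 0) : ∃ r > 0, HasDiscSection p W z₀ r := by
  obtain ⟨e, hze, he⟩ := hp z₀
  have hO : IsOpen (e.source ∩ W) := e.open_source.inter hW
  have h0 : p '' (e.source ∩ W) ∈ 𝓝 (0 : ℂ) := by
    have := hp.isOpenMap.image_mem_nhds (hO.mem_nhds ⟨hze, hz₀⟩)
    rwa [hpz] at this
  obtain ⟨r, hr, hball⟩ := Metric.mem_nhds_iff.1 h0
  refine ⟨r, hr, hasDiscSection_of_injOn hp hpz hO inter_subset_right ⟨hze, hz₀⟩ ?_ hball⟩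
  rw [he]
  exact e.injOn.mono inter_subset_left

/-- If the image of a section over a disc of radius `r` has a limit point over the boundary circle,
and this point lies on a preconnected subset of `W` which covers the circle, then there is a section
over a larger disc. -/
lemma exists_hasDiscSection_gt [T2Space E] (hp : IsLocalHomeomorph p) {W : Set E} {z₀ : E}
    (hW : IsOpen W) (hpz : p z₀ = 0) {r : ℝ} (hr : 0 < r) {s : ℂ → E}
    (hs : ContinuousOn s (Metric.ball 0 r)) (hs0 : s 0 = z₀)
    (hps : ∀ w ∈ Metric.ball 0 r, s w ∈ W ∧ p (s w) = w)
    {C : Set E} (hC : IsPreconnected C) (hCW : C ⊆ W) (hpC : p '' C = Metric.sphere 0 r) {y : E}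
    (hyC : y ∈ C) (hy : y ∈ closure (s '' Metric.ball 0 r)) :
    ∃ r' > r, HasDiscSection p W z₀ r' := by
  have hcl : closure (Metric.ball (0 : ℂ) r) = Metric.closedBall 0 r := closure_ball _ hr.ne'
  have hps' : ∀ w ∈ Metric.ball 0 r, p (s w) = w := fun w hw => (hps w hw).2
  have hD : Convex ℝ (Metric.ball (0 : ℂ) r) := convex_ball _ _
  set K := closure (s '' Metric.ball 0 r) with hK
  have hinj : InjOn p K := injOn_closure_image_section hp hD hs hps'
  have hpK : ∀ x ∈ K, p x ∈ Metric.closedBall (0 : ℂ) r := fun x hx =>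
    hcl ▸ map_mem_closure_of_section hp.continuous hps' hx
  have hCK : C ⊆ K := by
    refine subset_closure_image_section hp hD hs hps' hC (fun x hx => ?_) hyC hy
    rw [hcl]
    exact Metric.sphere_subset_closedBall (hpC ▸ mem_image_of_mem p hx)
  have hlift : ∀ w ∈ Metric.closedBall (0 : ℂ) r, ∃ x ∈ K ∩ W, p x = w := by
    intro w hw
    rw [← Metric.ball_union_sphere] at hw
    rcases hw with hw | hw
    · exact ⟨s w, ⟨subset_closure ⟨w, hw, rfl⟩, (hps w hw).1⟩, (hps w hw).2⟩
    · rw [← hpC] at hw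
      obtain ⟨x, hx, rfl⟩ := hw
      exact ⟨x, ⟨hCK hx, hCW hx⟩, rfl⟩
  have hKW : K ⊆ W := by
    intro x hx
    obtain ⟨x', hx', hpx⟩ := hlift (p x) (hpK x hx)
    rw [← hinj hx'.1 hx hpx]
    exact hx'.2
  have : Nonempty E := ⟨y⟩
  choose! g hg hpg using hlift
  have hgc : ContinuousOn g (Metric.closedBall 0 r) := by
    intro w hw
    obtain ⟨e, ε, hε, he, hye, hball, heq⟩ :=
      exists_symm_eqOn_section hp hD hs hps' (hg w hw).1
    rw [hpg w hw] at hball heq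
    have hwε : w ∈ Metric.ball w ε := Metric.mem_ball_self hε
    have heg : ∀ v ∈ Metric.closedBall (0 : ℂ) r, v ∈ Metric.ball w ε → g v = e.symm v := by
      intro v hv hvε
      have hv' : v ∈ closure (Metric.ball (0 : ℂ) r) := by rwa [hcl]
      refine hinj (hg v hv).1 (symm_mem_closure_image_section hball heq hvε hv') ?_
      rw [hpg v hv, he, e.right_inv (hball hvε)]
    have hc := (e.continuousAt_symm (hball hwε)).continuousWithinAt (s := Metric.closedBall 0 r)
    refine hc.congr_of_eventuallyEq ?_ (heg w hw hwε)
    filter_upwards [self_mem_nhdsWithin,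
      mem_nhdsWithin_of_mem_nhds (Metric.ball_mem_nhds w hε)] with v hv hvε using heg v hv hvε
  have hKg : K = g '' Metric.closedBall 0 r := by
    refine Subset.antisymm (fun x hx => ⟨p x, hpK x hx, ?_⟩) ?_
    · exact hinj (hg _ (hpK x hx)).1 hx (hpg _ (hpK x hx))
    · rintro _ ⟨w, hw, rfl⟩
      exact (hg w hw).1
  have hKc : IsCompact K := hKg ▸ (isCompact_closedBall _ _).image_of_continuousOn hgc
  obtain ⟨t, ht, htinj⟩ := hinj.exists_mem_nhdsSet hKc
    (fun x _ => hp.continuous.continuousAt) (fun x _ => by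
      obtain ⟨u, hu, hxu, hui⟩ := hp.isLocallyInjective x
      exact ⟨u, hu.mem_nhds hxu, hui⟩)
  obtain ⟨O, hO, hKO, hOt⟩ := mem_nhdsSet_iff_exists.1 ht
  have hOW : IsOpen (O ∩ W) := hO.inter hW
  have hKOW : K ⊆ O ∩ W := subset_inter hKO hKW
  obtain ⟨δ, hδ, hthick⟩ := (isCompact_closedBall (0 : ℂ) r).exists_thickening_subset_open
    (hp.isOpenMap _ hOW) (fun w hw => ⟨g w, hKOW (hg w hw).1, hpg w hw⟩)
  rw [thickening_closedBall hδ hr.le] at hthick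
  refine ⟨δ + r, by linarith, hasDiscSection_of_injOn hp hpz hOW inter_subset_right
    (hKOW (subset_closure ⟨0, Metric.mem_ball_self hr, hs0⟩))
    (htinj.mono (inter_subset_left.trans hOt)) hthick⟩

/-- The image of a section over an open convex set is everything if it contains all of its limit
points in the preconnected set `W`. -/
lemma image_section_eq [T2Space E] (hp : IsLocalHomeomorph p) {W : Set E}
    (hWc : IsPreconnected W) {D : Set ℂ} (hDo : IsOpen D) (hD : Convex ℝ D) (hDn : D.Nonempty)
    {s : ℂ → E} (hs : ContinuousOn s D) (hps : ∀ w ∈ D, s w ∈ W ∧ p (s w) = w)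
    (hWD : ∀ y ∈ W, y ∈ closure (s '' D) → p y ∈ D) : s '' D = W := by
  have hps' : ∀ w ∈ D, p (s w) = w := fun w hw => (hps w hw).2
  have hinj := injOn_closure_image_section hp hD hs hps'
  refine Subset.antisymm (by rintro _ ⟨w, hw, rfl⟩; exact (hps w hw).1) ?_
  have hopen : IsOpen (s '' D) := by
    rw [isOpen_iff_mem_nhds]
    rintro _ ⟨w, hw, rfl⟩
    obtain ⟨e, ε, hε, he, hye, hball, heq⟩ :=
      exists_symm_eqOn_section hp hD hs hps' (subset_closure ⟨w, hw, rfl⟩)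
    filter_upwards [e.open_source.mem_nhds hye, hp.continuous.continuousAt.preimage_mem_nhds
      (Metric.ball_mem_nhds _ hε), hp.continuous.continuousAt.preimage_mem_nhds
      (hDo.mem_nhds ((hps' w hw).symm ▸ hw))] with x hx hxε hxD
    refine ⟨p x, hxD, ?_⟩
    rw [← heq ⟨hxε, hxD⟩, he, e.left_inv hx]
  obtain ⟨w₀, hw₀⟩ := hDn
  refine hWc.subset_of_closure_inter_subset hopen ⟨s w₀, (hps w₀ hw₀).1, w₀, hw₀, rfl⟩ ?_
  rintro y ⟨hy, hyW⟩
  have hpy := hWD y hyW hy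
  exact ⟨p y, hpy, hinj (subset_closure ⟨_, hpy, rfl⟩) hy (hps' _ hpy)⟩

/-- Let `p` be a local homeomorphism to the plane and `W` a connected open set such that each point
of `W` lies on a connected subset of `W` covering a full circle about the origin. Then `p` is
injective on the closure of `W`, and `p '' W` is the plane or a disc. -/
theorem injOn_closure_of_circles [T2Space E] (hp : IsLocalHomeomorph p) {W : Set E} {z₀ : E}
    (hW : IsOpen W) (hWc : IsPreconnected W) (hz₀ : z₀ ∈ W) (hpz : p z₀ = 0)
    (hcirc : ∀ y ∈ W, ∃ C ⊆ W, IsPreconnected C ∧ y ∈ C ∧ p '' C = Metric.sphere 0 ‖p y‖) :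
    InjOn p (closure W) ∧ (p '' W = univ ∨ ∃ r > 0, p '' W = Metric.ball 0 r) := by
  obtain ⟨r₀, hr₀, hgood₀⟩ := exists_hasDiscSection hp hW hz₀ hpz
  set R : Set ℝ := {r | 0 < r ∧ HasDiscSection p W z₀ r} with hR
  have : Nonempty E := ⟨z₀⟩
  choose! σ hσc hσ0 hσ using fun r (hr : r ∈ R) => hr.2
  have hagree : ∀ r ∈ R, ∀ r' ∈ R, r ≤ r' → EqOn (σ r) (σ r') (Metric.ball 0 r) := by
    intro r hr r' hr' hle
    have hsub : Metric.ball (0 : ℂ) r ⊆ Metric.ball 0 r' := Metric.ball_subset_ball hle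
    refine (T2Space.isSeparatedMap p).eqOn_of_comp_eqOn hp.isLocallyInjective
      (convex_ball (0 : ℂ) r).isPreconnected (hσc r hr) ((hσc r' hr').mono hsub) ?_
      (Metric.mem_ball_self hr.1) ((hσ0 r hr).trans (hσ0 r' hr').symm)
    intro w hw
    simp only [Function.comp_apply, (hσ r hr w hw).2, (hσ r' hr' w (hsub hw)).2]
  have hex : ∀ w ∈ ⋃ r ∈ R, Metric.ball (0 : ℂ) r, ∃ r ∈ R, w ∈ Metric.ball (0 : ℂ) r :=
    fun w hw => by simpa using hw
  set D : Set ℂ := ⋃ r ∈ R, Metric.ball (0 : ℂ) r with hDdef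
  have hDo : IsOpen D := isOpen_biUnion fun _ _ => Metric.isOpen_ball
  choose! ρ hρR hρ using hex
  let s : ℂ → E := fun w => σ (ρ w) w
  have hsσ : ∀ r ∈ R, EqOn s (σ r) (Metric.ball 0 r) := by
    intro r hr w hw
    have hwD : w ∈ D := mem_biUnion hr hw
    rcases le_total (ρ w) r with h | h
    · exact hagree _ (hρR w hwD) _ hr h (hρ w hwD)
    · exact (hagree _ hr _ (hρR w hwD) h hw).symm
  have hsc : ContinuousOn s D := by
    intro w hw
    have hr := hρR w hw
    have hb : Metric.ball (0 : ℂ) (ρ w) ∈ 𝓝 w := Metric.isOpen_ball.mem_nhds (hρ w hw)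
    refine ContinuousAt.continuousWithinAt ?_
    refine ((hσc _ hr).continuousAt hb).congr ?_
    filter_upwards [hb] with v hv using (hsσ _ hr hv).symm
  have hps : ∀ w ∈ D, s w ∈ W ∧ p (s w) = w := fun w hw => hσ _ (hρR w hw) w (hρ w hw)
  have hr₀R : r₀ ∈ R := ⟨hr₀, hgood₀⟩
  have h0D : (0 : ℂ) ∈ D := mem_biUnion hr₀R (Metric.mem_ball_self hr₀)
  have hs0 : s 0 = z₀ := hσ0 _ (hρR 0 h0D)
  have finish : Convex ℝ D → (∀ y ∈ W, y ∈ closure (s '' D) → p y ∈ D) →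
      InjOn p (closure W) ∧ p '' W = D := by
    intro hD hWD
    have himg := image_section_eq hp hWc hDo hD ⟨0, h0D⟩ hsc hps hWD
    rw [← himg]
    refine ⟨injOn_closure_image_section hp hD hsc fun w hw => (hps w hw).2, ?_⟩
    rw [image_image]
    exact (image_congr fun w hw => (hps w hw).2).trans (image_id D)
  by_cases hbdd : BddAbove R
  · have hDball : D = Metric.ball 0 (sSup R) := by
      ext w
      simp only [hDdef, mem_iUnion, mem_ball_zero_iff, exists_prop]
      exact (lt_csSup_iff hbdd ⟨r₀, hr₀R⟩).symm
    have hpos : 0 < sSup R := hr₀.trans_le (le_csSup hbdd hr₀R)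
    have hWD : ∀ y ∈ W, y ∈ closure (s '' D) → p y ∈ D := by
      intro y hyW hy
      have hpy := map_mem_closure_of_section hp.continuous (fun w hw => (hps w hw).2) hy
      by_contra hnot
      rw [hDball] at hsc hps hy hpy hnot
      rw [closure_ball _ hpos.ne', mem_closedBall_zero_iff] at hpy
      rw [mem_ball_zero_iff, not_lt] at hnot
      obtain ⟨C, hCW, hC, hyC, hpC⟩ := hcirc y hyW
      rw [le_antisymm hpy hnot] at hpC
      obtain ⟨r', hr', hgood⟩ :=
        exists_hasDiscSection_gt hp hW hpz hpos hsc hs0 hps hC hCW hpC hyC hy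
      exact absurd (le_csSup hbdd ⟨hpos.trans hr', hgood⟩) (not_le.2 hr')
    obtain ⟨h1, h2⟩ := finish (hDball ▸ convex_ball _ _) hWD
    exact ⟨h1, Or.inr ⟨sSup R, hpos, h2.trans hDball⟩⟩
  · have hDuniv : D = univ := by
      rw [eq_univ_iff_forall]
      intro w
      obtain ⟨r, hr, hwr⟩ := not_bddAbove_iff.1 hbdd ‖w‖
      exact mem_biUnion hr (mem_ball_zero_iff.2 hwr)
    obtain ⟨h1, h2⟩ := finish (hDuniv ▸ convex_univ) fun y _ _ => hDuniv ▸ mem_univ _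
    exact ⟨h1, Or.inl (h2.trans hDuniv)⟩

end LocalHomeomorphSections

/-- A plane curve satisfying `β' = i d β` with `d` periodic, continuous and nowhere zero covers the
whole circle through its initial point. -/
lemma range_eq_sphere_of_rotation {β : ℝ → ℂ} {d : ℝ → ℝ} {T : ℝ} (hT : 0 < T)
    (hd : Continuous d) (hd0 : ∀ t, d t ≠ 0) (hdT : Function.Periodic d T)
    (hβ : ∀ t, HasDerivAt β (Complex.I * d t * β t) t) :
    range β = Metric.sphere 0 ‖β 0‖ := by
  set θ : ℝ → ℝ := fun t => ∫ u in (0 : ℝ)..t, d u with hθ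
  have hθ' : ∀ t, HasDerivAt θ (d t) t := fun t =>
    intervalIntegral.integral_hasDerivAt_right (hd.intervalIntegrable _ _)
      hd.stronglyMeasurable.stronglyMeasurableAtFilter hd.continuousAt
  have hθc : Continuous θ := continuous_iff_continuousAt.2 fun t => (hθ' t).continuousAt
  have hform : ∀ t, β t = β 0 * Complex.exp (θ t * Complex.I) := by
    have hexp : ∀ t, HasDerivAt (fun t => Complex.exp (-(θ t * Complex.I)))
        (Complex.exp (-(θ t * Complex.I)) * -(d t * Complex.I)) t := fun t =>
      (((hθ' t).ofReal_comp.mul_const Complex.I).neg).cexp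
    have hconst : ∀ t, HasDerivAt (fun t => β t * Complex.exp (-(θ t * Complex.I))) 0 t := by
      intro t
      refine ((hβ t).mul (hexp t)).congr_deriv ?_
      ring
    intro t
    have h := is_const_of_deriv_eq_zero (fun t => (hconst t).differentiableAt)
      (fun t => (hconst t).deriv) t 0
    have h0 : θ 0 = 0 := intervalIntegral.integral_same
    simp only [h0, Complex.ofReal_zero, zero_mul, neg_zero, Complex.exp_zero, mul_one] at h
    rw [← h, mul_assoc, ← Complex.exp_add]
    simp
  have hθT : θ T ≠ 0 := by
    intro h
    have h0 : θ 0 = 0 := intervalIntegral.integral_same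
    obtain ⟨c, -, hc⟩ := exists_hasDerivAt_eq_zero hT hθc.continuousOn (h0.trans h.symm)
      fun t _ => hθ' t
    exact hd0 c hc
  have hθn : ∀ n : ℤ, θ (n * T) = n * θ T := by
    intro n
    have := hdT.intervalIntegral_add_zsmul_eq n 0 fun a b => hd.intervalIntegrable a b
    simpa using this
  have hsurj : ∀ x, ∃ t, θ t = x := by
    intro x
    obtain ⟨n, hn⟩ := exists_int_ge (x / θ T)
    obtain ⟨m, hm⟩ := exists_int_le (x / θ T)
    have hpre : IsPreconnected (range θ) := isPreconnected_range hθc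
    have hmn : ∀ k : ℤ, (k : ℝ) * θ T ∈ range θ := fun k => ⟨_, hθn k⟩
    have hx : x = x / θ T * θ T := (div_mul_cancel₀ x hθT).symm
    rcases lt_or_gt_of_ne hθT with h | h
    · exact hpre.Icc_subset (hmn n) (hmn m)
        ⟨by rw [hx]; exact mul_le_mul_of_nonpos_right hn h.le,
          by rw [hx]; exact mul_le_mul_of_nonpos_right hm h.le⟩
    · exact hpre.Icc_subset (hmn m) (hmn n)
        ⟨by rw [hx]; exact mul_le_mul_of_nonneg_right hm h.le,
          by rw [hx]; exact mul_le_mul_of_nonneg_right hn h.le⟩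
  refine Subset.antisymm ?_ fun w hw => ?_
  · rintro _ ⟨t, rfl⟩
    rw [mem_sphere_zero_iff_norm, hform t, norm_mul, Complex.norm_exp_ofReal_mul_I, mul_one]
  · rw [mem_sphere_zero_iff_norm] at hw
    by_cases h0 : β 0 = 0
    · rw [h0, norm_zero, norm_eq_zero] at hw
      exact ⟨0, by rw [h0, hw]⟩
    · obtain ⟨t, ht⟩ := hsurj (Complex.arg (w / β 0))
      have hn : ‖w / β 0‖ = 1 := by
        rw [norm_div, hw, div_self (norm_ne_zero_iff.2 h0)]
      refine ⟨t, ?_⟩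
      have h := Complex.norm_mul_exp_arg_mul_I (w / β 0)
      rw [hn, Complex.ofReal_one, one_mul] at h
      rw [hform t, ht, h, mul_div_cancel₀ w h0]

/-- The plane-valued map `f` regarded as a complex-valued map. -/
noncomputable def toComplex (f : ℝ × ℝ → ℝ × ℝ) (z : ℝ × ℝ) : ℂ :=
  Complex.equivRealProdCLM.symm (f z)

lemma norm_toComplex (f : ℝ × ℝ → ℝ × ℝ) (z : ℝ × ℝ) : ‖toComplex f z‖ = euclNorm (f z) := by
  rw [euclNorm, toComplex, Complex.norm_eq_sqrt_sq_add_sq]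
  rfl

lemma fderiv_apply_eq {g : ℝ × ℝ → ℝ} (z v : ℝ × ℝ) :
    fderiv ℝ g z v = v.1 * pdx g z + v.2 * pdy g z := by
  have hv : v = v.1 • ((1, 0) : ℝ × ℝ) + v.2 • ((0, 1) : ℝ × ℝ) := by ext <;> simp
  conv_lhs => rw [hv]
  simp only [map_add, map_smul, smul_eq_mul, pdx, pdy]

lemma fderiv_injective_of_jacDet_ne_zero {f : ℝ × ℝ → ℝ × ℝ} {z : ℝ × ℝ}
    (hf : DifferentiableAt ℝ f z) (hdet : jacDet f z ≠ 0) :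
    Function.Injective (fderiv ℝ f z) := by
  rw [injective_iff_map_eq_zero]
  intro v hv
  have h1 : v.1 * pdx (fun w => (f w).1) z + v.2 * pdy (fun w => (f w).1) z = 0 := by
    rw [← fderiv_apply_eq, hf.hasFDerivAt.fst.fderiv]
    simp [hv]
  have h2 : v.1 * pdx (fun w => (f w).2) z + v.2 * pdy (fun w => (f w).2) z = 0 := by
    rw [← fderiv_apply_eq, hf.hasFDerivAt.snd.fderiv]
    simp [hv]
  have e1 : v.1 * jacDet f z = 0 := by
    rw [jacDet]
    linear_combination pdy (fun w => (f w).2) z * h1 - pdy (fun w => (f w).1) z * h2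
  have e2 : v.2 * jacDet f z = 0 := by
    rw [jacDet]
    linear_combination pdx (fun w => (f w).1) z * h2 - pdx (fun w => (f w).2) z * h1
  exact Prod.ext ((mul_eq_zero.1 e1).resolve_right hdet) ((mul_eq_zero.1 e2).resolve_right hdet)

lemma isLocalHomeomorph_restrict_toComplex {U : Set (ℝ × ℝ)} (hU : IsOpen U)
    {f : ℝ × ℝ → ℝ × ℝ} (hf : ContDiffOn ℝ 2 f U) (hdet : ∀ z ∈ U, jacDet f z ≠ 0) :
    IsLocalHomeomorph fun z : U => toComplex f z := by
  have hloc : IsLocalHomeomorphOn f U := by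
    intro z hz
    have hfz : ContDiffAt ℝ 2 f z := hf.contDiffAt (hU.mem_nhds hz)
    have hdiff : DifferentiableAt ℝ f z := hfz.differentiableAt (by norm_num)
    let L : (ℝ × ℝ) ≃L[ℝ] ℝ × ℝ := (LinearEquiv.ofInjectiveEndo (fderiv ℝ f z).toLinearMap
      (fderiv_injective_of_jacDet_ne_zero hdiff (hdet z hz))).toContinuousLinearEquiv
    have hL : HasFDerivAt f (L : ℝ × ℝ →L[ℝ] ℝ × ℝ) z := by
      have : (L : ℝ × ℝ →L[ℝ] ℝ × ℝ) = fderiv ℝ f z := rfl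
      rw [this]
      exact hdiff.hasFDerivAt
    exact ⟨hfz.toOpenPartialHomeomorph f hL (by norm_num),
      hfz.mem_toOpenPartialHomeomorph_source hL (by norm_num),
      (hfz.toOpenPartialHomeomorph_coe hL (by norm_num)).symm⟩
  have hval : IsLocalHomeomorph (fun z : U => f z) := by
    rw [isLocalHomeomorph_iff_isLocalHomeomorphOn_univ]
    exact hloc.comp hU.isOpenEmbedding_subtypeVal.isLocalHomeomorph.isLocalHomeomorphOn
      fun z _ => z.2
  exact Complex.equivRealProdCLM.symm.toHomeomorph.isLocalHomeomorph.comp hval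

/-- Along solutions of the Hamiltonian system, `f` rotates with angular velocity `det Df`. -/
lemma hasDerivAt_toComplex_comp {f : ℝ × ℝ → ℝ × ℝ} {γ : ℝ → ℝ × ℝ} {t : ℝ}
    (hf : DifferentiableAt ℝ f (γ t)) (hγ : HasDerivAt γ (hamVF f (γ t)) t) :
    HasDerivAt (fun t => toComplex f (γ t))
      (Complex.I * jacDet f (γ t) * toComplex f (γ t)) t := by
  set z := γ t with hz
  have h1 := hf.hasFDerivAt.fst
  have h2 := hf.hasFDerivAt.snd
  have hH : HasFDerivAt (Ham f) ((f z).1 • fderiv ℝ (fun w => (f w).1) z +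
      (f z).2 • fderiv ℝ (fun w => (f w).2) z) z := by
    rw [h1.fderiv, h2.fderiv]
    have hHam : Ham f = fun w => ((f w).1 ^ 2 + (f w).2 ^ 2) * (1 / 2) := by
      funext w
      rw [Ham]
      ring
    rw [hHam]
    refine (((h1.pow 2).add (h2.pow 2)).mul_const ((1 : ℝ) / 2)).congr_fderiv ?_
    ext <;> simp <;> ring
  have hx : pdx (Ham f) z = (f z).1 * pdx (fun w => (f w).1) z +
      (f z).2 * pdx (fun w => (f w).2) z := by
    rw [pdx, hH.fderiv]; rfl
  have hy : pdy (Ham f) z = (f z).1 * pdy (fun w => (f w).1) z +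
      (f z).2 * pdy (fun w => (f w).2) z := by
    rw [pdy, hH.fderiv]; rfl
  have hcomp := hf.hasFDerivAt.comp_hasDerivAt t hγ
  have hC := (Complex.equivRealProdCLM.symm : ℝ × ℝ →L[ℝ] ℂ).hasFDerivAt.comp_hasDerivAt t hcomp
  have e1 : (fderiv ℝ f z (hamVF f z)).1 = -(jacDet f z * (f z).2) := by
    have := fderiv_apply_eq (g := fun w => (f w).1) z (hamVF f z)
    rw [h1.fderiv] at this
    refine Eq.trans this ?_
    simp only [hamVF, hx, hy, jacDet]
    ring
  have e2 : (fderiv ℝ f z (hamVF f z)).2 = jacDet f z * (f z).1 := by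
    have := fderiv_apply_eq (g := fun w => (f w).2) z (hamVF f z)
    rw [h2.fderiv] at this
    refine Eq.trans this ?_
    simp only [hamVF, hx, hy, jacDet]
    ring
  refine hC.congr_deriv (Complex.ext ?_ ?_)
  · refine e1.trans ?_
    simp [toComplex]
  · refine e2.trans ?_
    simp [toComplex]

lemma continuousOn_jacDet {U : Set (ℝ × ℝ)} (hU : IsOpen U) {f : ℝ × ℝ → ℝ × ℝ}
    (hf : ContDiffOn ℝ 2 f U) : ContinuousOn (jacDet f) U := by
  have h1 : ContinuousOn (fderiv ℝ fun w => (f w).1) U :=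
    (contDiff_fst.comp_contDiffOn hf).continuousOn_fderiv_of_isOpen hU (by norm_num)
  have h2 : ContinuousOn (fderiv ℝ fun w => (f w).2) U :=
    (contDiff_snd.comp_contDiffOn hf).continuousOn_fderiv_of_isOpen hU (by norm_num)
  unfold jacDet pdx pdy
  fun_prop

/-- `f` maps the image of a periodic solution onto a full circle. -/
lemma range_toComplex_comp_eq_sphere {U : Set (ℝ × ℝ)} (hU : IsOpen U) {f : ℝ × ℝ → ℝ × ℝ}
    (hf : ContDiffOn ℝ 2 f U) (hdet : ∀ z ∈ U, jacDet f z ≠ 0) {γ : ℝ → ℝ × ℝ}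
    (hγ : IsPeriodicSolOn (hamVF f) U γ) :
    range (fun t => toComplex f (γ t)) = Metric.sphere 0 ‖toComplex f (γ 0)‖ := by
  obtain ⟨hγU, hγ', ⟨T, hT, hper⟩, -⟩ := hγ
  have hγc : Continuous γ := continuous_iff_continuousAt.2 fun t => (hγ' t).continuousAt
  refine range_eq_sphere_of_rotation (β := fun t => toComplex f (γ t))
    (d := fun t => jacDet f (γ t)) hT
    ((continuousOn_jacDet hU hf).comp_continuous hγc hγU) (fun t => hdet _ (hγU t))
    (fun t => by simp only [hper t]) fun t => hasDerivAt_toComplex_comp ?_ (hγ' t)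
  exact (hf.contDiffAt (hU.mem_nhds (hγU t))).differentiableAt (by norm_num)

theorem injective_on_closure_of_period_annulus (U : Set (ℝ × ℝ)) (hUo : IsOpen U)
    (hUc : IsConnected U) (f : ℝ × ℝ → ℝ × ℝ) (hf : ContDiffOn ℝ 2 f U)
    (hdet : ∀ z ∈ U, jacDet f z ≠ 0)
    (z₀ : ℝ × ℝ) (hz₀ : z₀ ∈ U) (hfz : f z₀ = (0, 0))
    (W : Set (ℝ × ℝ)) (hW : IsPeriodAnnulus (hamVF f) U z₀ W) :
    Set.InjOn f (closure W ∩ U) ∧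
      (f '' W = Set.univ ∨ ∃ r > 0, f '' W = disc r) := by
  obtain ⟨hz₀W, hWU, hWo, hWc, hper, -⟩ := hW
  set p : U → ℂ := fun z => toComplex f z with hpdef
  have hp : IsLocalHomeomorph p := isLocalHomeomorph_restrict_toComplex hUo hf hdet
  set V : Set U := Subtype.val ⁻¹' W with hV
  have hVW : Subtype.val '' V = W := by rw [hV, Subtype.image_preimage_coe, inter_eq_right.2 hWU]
  have hpz : p ⟨z₀, hz₀⟩ = 0 := by
    simp only [hpdef, toComplex, hfz]
    exact map_zero Complex.equivRealProdCLM.symm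
  have hVc : IsPreconnected V := by
    rw [← Topology.IsInducing.subtypeVal.isPreconnected_image, hVW]
    exact hWc.isPreconnected
  have hcirc : ∀ y ∈ V, ∃ C ⊆ V, IsPreconnected C ∧ y ∈ C ∧
      p '' C = Metric.sphere 0 ‖p y‖ := by
    intro y hy
    by_cases hyz : (y : ℝ × ℝ) = z₀
    · have hy0 : y = ⟨z₀, hz₀⟩ := Subtype.ext hyz
      refine ⟨{y}, singleton_subset_iff.2 hy, isPreconnected_singleton, mem_singleton y, ?_⟩
      rw [image_singleton, hy0, hpz, norm_zero, Metric.sphere_zero]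
    · obtain ⟨γ, hγ, hγ0⟩ := hper y ⟨hy, hyz⟩
      have hγU : ∀ t, γ t ∈ U := fun t => hWU (hγ.1 t)
      have hγc : Continuous γ := continuous_iff_continuousAt.2 fun t => (hγ.2.1 t).continuousAt
      have hrange := range_toComplex_comp_eq_sphere hUo hf hdet ⟨hγU, hγ.2⟩
      refine ⟨range fun t => (⟨γ t, hγU t⟩ : U), ?_, isPreconnected_range (hγc.subtype_mk hγU),
        ⟨0, Subtype.ext hγ0⟩, ?_⟩
      · rintro _ ⟨t, rfl⟩
        exact hγ.1 t
      · rw [← range_comp]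
        rw [hγ0] at hrange
        exact hrange
  obtain ⟨hinj, himg⟩ := injOn_closure_of_circles hp (hWo.preimage continuous_subtype_val)
    hVc (z₀ := ⟨z₀, hz₀⟩) hz₀W hpz hcirc
  have hmemV : ∀ x (hx : x ∈ U), x ∈ closure W → (⟨x, hx⟩ : U) ∈ closure V := by
    intro x hx hxW
    rw [closure_subtype, hVW]
    exact hxW
  have hpV : p '' V = Complex.equivRealProdCLM.symm '' (f '' W) := by
    rw [← hVW, image_image, image_image]
    rfl
  have hfW : f '' W = Complex.equivRealProdCLM.symm ⁻¹' (p '' V) := by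
    rw [hpV, preimage_image_eq _ Complex.equivRealProdCLM.symm.injective]
  refine ⟨?_, ?_⟩
  · rintro x ⟨hxW, hx⟩ y ⟨hyW, hy⟩ hxy
    exact congrArg Subtype.val (hinj (hmemV x hx hxW) (hmemV y hy hyW)
      (congrArg Complex.equivRealProdCLM.symm hxy))
  · rcases himg with h | ⟨r, hr, h⟩
    · left
      rw [hfW, h, preimage_univ]
    · refine Or.inr ⟨r, hr, ?_⟩
      rw [hfW, h]
      ext w
      rw [mem_preimage, mem_ball_zero_iff]
      exact (norm_toComplex id w).symm ▸ Iff.rfl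
end

section
/- Let U ⊆ ℝ² be an open connected set, f = (f₁, f₂) : U → ℝ² a C² map with det Df(z) ≠ 0 for every z ∈ U, and z₀ ∈ U a point with f(z₀) = (0,0). Let V ⊆ U be an open connected set containing z₀ such that f restricted to V is injective and f(V) = ℝ² or f(V) is an open disc centered at the origin. Then every point of V \ {z₀} lies on a periodic solution of ∇H_f^⊥ whose image is contained in V; in particular V is contained in the period annulus of the center z₀. -/
open Real Set

open Filter Topology

/-- A scalar autonomous equation with a positive, continuous, periodic right-hand side has a
global solution through `0` that advances by one spatial period in some positive time. -/
lemma exists_rotating_solution_of_pos {h : ℝ → ℝ} (hc : Continuous h) (hpos : ∀ x, 0 < h x)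
    {P : ℝ} (hP : 0 < P) (hper : Function.Periodic h P) :
    ∃ θ : ℝ → ℝ, θ 0 = 0 ∧ Function.Surjective θ ∧ (∀ t, HasDerivAt θ (h (θ t)) t) ∧
      ∃ T > 0, ∀ t, θ (t + T) = θ t + P := by
  set k : ℝ → ℝ := fun x => (h x)⁻¹ with hk
  have kc : Continuous k := hc.inv₀ fun x => (hpos x).ne'
  have kpos : ∀ x, 0 < k x := fun x => inv_pos.2 (hpos x)
  have kper : Function.Periodic k P := fun x => by simp only [hk, hper x]
  have kint : ∀ a b, IntervalIntegrable k MeasureTheory.volume a b :=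
    fun a b => kc.intervalIntegrable a b
  set Φ : ℝ → ℝ := fun x => ∫ u in (0 : ℝ)..x, k u with hΦ
  have Φd : ∀ x, HasDerivAt Φ (k x) x := fun x => kc.integral_hasStrictDerivAt 0 x |>.hasDerivAt
  have Φmono : StrictMono Φ := strictMono_of_hasDerivAt_pos Φd kpos
  have Φcont : Continuous Φ := continuous_iff_continuousAt.2 fun x => (Φd x).continuousAt
  have Φsurj : Function.Surjective Φ := Φcont.surjective
    (kper.tendsto_atTop_intervalIntegral_of_pos' (kint _ _) kpos hP)
    (kper.tendsto_atBot_intervalIntegral_of_pos' (kint _ _) kpos hP)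
  set e := Φmono.orderIsoOfSurjective Φ Φsurj with he
  have eΦ : ∀ t, Φ (e.symm t) = t := fun t => e.apply_symm_apply t
  have Φe : ∀ x, e.symm (Φ x) = x := fun x => e.symm_apply_apply x
  have Φ0 : Φ 0 = 0 := by simp [hΦ]
  refine ⟨e.symm, ?_, e.symm.surjective, fun t => ?_, Φ P, ?_, fun t => ?_⟩
  · simpa only [Φ0] using Φe 0
  · have := HasDerivAt.of_local_left_inverse (e.symm.continuous.continuousAt (x := t))
      (Φd (e.symm t)) (kpos _).ne' (Eventually.of_forall eΦ)
    simpa [hk] using this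
  · rw [← Φ0]
    exact Φmono hP
  · apply Φmono.injective
    rw [eΦ]
    have := kper.intervalIntegral_add_eq_add 0 (e.symm t) kint
    simp only [zero_add] at this
    change Φ (e.symm t + P) = Φ (e.symm t) + Φ P at this
    rw [this, eΦ]

/-- A scalar autonomous equation with a nowhere zero, continuous, periodic right-hand side has a
global solution through `0` that moves by one spatial period, in either direction, in some
positive time. -/
lemma exists_rotating_solution {h : ℝ → ℝ} (hc : Continuous h) (hne : ∀ x, h x ≠ 0)
    {P : ℝ} (hP : 0 < P) (hper : Function.Periodic h P) :
    ∃ θ : ℝ → ℝ, θ 0 = 0 ∧ Function.Surjective θ ∧ (∀ t, HasDerivAt θ (h (θ t)) t) ∧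
      ∃ T > 0, (∀ t, θ (t + T) = θ t + P) ∨ (∀ t, θ (t + T) = θ t - P) := by
  have hsign : (∀ x, 0 < h x) ∨ (∀ x, h x < 0) := by
    by_contra! H
    obtain ⟨⟨x, hx⟩, y, hy⟩ := H
    obtain ⟨z, hz⟩ := mem_range_of_exists_le_of_exists_ge hc ⟨x, hx⟩ ⟨y, hy⟩
    exact hne z hz
  rcases hsign with hpos | hneg
  · obtain ⟨θ, h0, hs, hd, T, hT, hp⟩ := exists_rotating_solution_of_pos hc hpos hP hper
    exact ⟨θ, h0, hs, hd, T, hT, Or.inl hp⟩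
  · obtain ⟨θ, h0, hs, hd, T, hT, hp⟩ := exists_rotating_solution_of_pos (h := fun x => -h x)
      hc.neg (fun x => neg_pos.2 (hneg x)) hP (fun x => by simp only [hper x])
    refine ⟨fun t => θ (-t), by simpa using h0, hs.comp neg_surjective, fun t => ?_,
      T, hT, Or.inr fun t => ?_⟩
    · have := (hd (-t)).scomp t (hasDerivAt_neg t)
      rwa [neg_one_smul, neg_neg] at this
    · have := hp (-(t + T))
      rw [show -(t + T) + T = -t by ring] at this
      linarith

/-- The value of a linear endomorphism of the plane in terms of its columns. -/
lemma clm_plane_apply (A : ℝ × ℝ →L[ℝ] ℝ × ℝ) (v : ℝ × ℝ) :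
    A v = v.1 • A (1, 0) + v.2 • A (0, 1) := by
  rw [← map_smul, ← map_smul, ← map_add]
  congr 1
  ext <;> simp

/-- A linear endomorphism of the plane with nonzero determinant is a continuous linear
equivalence. -/
lemma exists_equiv_of_det_ne_zero (A : ℝ × ℝ →L[ℝ] ℝ × ℝ)
    (hA : (A (1, 0)).1 * (A (0, 1)).2 - (A (1, 0)).2 * (A (0, 1)).1 ≠ 0) :
    ∃ e : (ℝ × ℝ) ≃L[ℝ] (ℝ × ℝ), (e : ℝ × ℝ →L[ℝ] ℝ × ℝ) = A := by
  have hinj : Function.Injective (A : ℝ × ℝ →ₗ[ℝ] ℝ × ℝ) := by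
    rw [injective_iff_map_eq_zero]
    intro v hv
    have hv' : v.1 • A (1, 0) + v.2 • A (0, 1) = 0 := by
      rw [← clm_plane_apply]; exact hv
    have h1 := congrArg Prod.fst hv'
    have h2 := congrArg Prod.snd hv'
    simp only [Prod.fst_add, Prod.snd_add, Prod.smul_fst, Prod.smul_snd, smul_eq_mul,
      Prod.fst_zero, Prod.snd_zero] at h1 h2
    ext
    · refine (mul_eq_zero.1 ?_).resolve_right hA
      linear_combination (A (0, 1)).2 * h1 - (A (0, 1)).1 * h2
    · refine (mul_eq_zero.1 ?_).resolve_right hA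
      linear_combination (A (1, 0)).1 * h2 - (A (1, 0)).2 * h1
  refine ⟨(LinearEquiv.ofInjectiveEndo _ hinj).toContinuousLinearEquiv, ?_⟩
  exact ContinuousLinearMap.ext fun _ => rfl

section Derivatives

variable {f : ℝ × ℝ → ℝ × ℝ} {z : ℝ × ℝ}

lemma jacDet_eq (hf : DifferentiableAt ℝ f z) :
    jacDet f z = (fderiv ℝ f z (1, 0)).1 * (fderiv ℝ f z (0, 1)).2 -
      (fderiv ℝ f z (1, 0)).2 * (fderiv ℝ f z (0, 1)).1 := by
  have h1 := hf.hasFDerivAt.fst.fderiv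
  have h2 := hf.hasFDerivAt.snd.fderiv
  simp only [jacDet, pdx, pdy, h1, h2]
  rfl

lemma fderiv_Ham_apply (hf : DifferentiableAt ℝ f z) (v : ℝ × ℝ) :
    fderiv ℝ (Ham f) z v =
      (f z).1 * (fderiv ℝ f z v).1 + (f z).2 * (fderiv ℝ f z v).2 := by
  have h := ((hf.hasFDerivAt.fst.pow 2).add (hf.hasFDerivAt.snd.pow 2)).mul_const (2⁻¹ : ℝ)
  have hH : HasFDerivAt (Ham f) _ z := h.congr_of_eventuallyEq
    (Eventually.of_forall fun w => by simp [Ham, div_eq_mul_inv])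
  rw [hH.fderiv]
  simp
  ring

/-- The derivative of `f` sends the Hamiltonian field to the rotation field scaled by the
Jacobian determinant. -/
lemma fderiv_hamVF (hf : DifferentiableAt ℝ f z) :
    fderiv ℝ f z (hamVF f z) = jacDet f z • (-(f z).2, (f z).1) := by
  rw [clm_plane_apply, jacDet_eq hf]
  simp only [hamVF, pdx, pdy, fderiv_Ham_apply hf]
  ext <;> simp <;> ring

end Derivatives

/-- Around each image point, a local inverse of an injective planar map with nonvanishing
Jacobian is differentiable. -/
lemma hasFDerivAt_of_rightInvOn {f g : ℝ × ℝ → ℝ × ℝ} {V : Set (ℝ × ℝ)} (hV : IsOpen V)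
    (hinj : InjOn f V) (hg : ∀ w ∈ f '' V, g w ∈ V ∧ f (g w) = w) {w : ℝ × ℝ}
    (hw : w ∈ f '' V) (e : (ℝ × ℝ) ≃L[ℝ] (ℝ × ℝ))
    (he : HasStrictFDerivAt f (e : ℝ × ℝ →L[ℝ] ℝ × ℝ) (g w)) :
    HasFDerivAt g (e.symm : ℝ × ℝ →L[ℝ] ℝ × ℝ) w := by
  obtain ⟨hgV, hgw⟩ := hg w hw
  have hmap : map f (𝓝 (g w)) = 𝓝 w := by
    rw [he.map_nhds_eq_of_equiv, hgw]
  have himg : ∀ N ∈ 𝓝 (g w), f '' N ∈ 𝓝 w := fun N hN => hmap ▸ image_mem_map hN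
  have hVn := hV.mem_nhds hgV
  refine HasFDerivAt.of_local_left_inverse ?_ he.hasFDerivAt ?_
  · intro N hN
    rw [mem_map]
    filter_upwards [himg _ (inter_mem hN hVn)]
    rintro _ ⟨x, ⟨hxN, hxV⟩, rfl⟩
    obtain ⟨h1, h2⟩ := hg (f x) ⟨x, hxV, rfl⟩
    change g (f x) ∈ N
    rwa [hinj h1 hxV h2]
  · filter_upwards [himg _ hVn] with y hy using (hg y hy).2

/-- If an injective planar map with nonvanishing Jacobian has the full circle through `f z` in
its image, then `z` lies on a periodic solution of the Hamiltonian field. -/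
lemma exists_periodicSol_of_circle_subset_image {f : ℝ × ℝ → ℝ × ℝ} {V : Set (ℝ × ℝ)}
    (hV : IsOpen V) (hf : ContDiffOn ℝ 1 f V) (hdet : ∀ z ∈ V, jacDet f z ≠ 0)
    (hinj : InjOn f V) {z : ℝ × ℝ} (hz : z ∈ V) (hfz : f z ≠ (0, 0))
    (hcirc : ∀ w : ℝ × ℝ, w.1 ^ 2 + w.2 ^ 2 = (f z).1 ^ 2 + (f z).2 ^ 2 → w ∈ f '' V) :
    ∃ γ, IsPeriodicSolOn (hamVF f) V γ ∧ γ 0 = z := by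
  have hfd : ∀ x ∈ V, DifferentiableAt ℝ f x := fun x hx =>
    (hf.contDiffAt (hV.mem_nhds hx)).differentiableAt one_ne_zero
  have hfs : ∀ x ∈ V, HasStrictFDerivAt f (fderiv ℝ f x) x := fun x hx =>
    (hf.contDiffAt (hV.mem_nhds hx)).hasStrictFDerivAt one_ne_zero
  have hequiv : ∀ x ∈ V, ∃ e : (ℝ × ℝ) ≃L[ℝ] (ℝ × ℝ),
      (e : ℝ × ℝ →L[ℝ] ℝ × ℝ) = fderiv ℝ f x := fun x hx =>
    exists_equiv_of_det_ne_zero _ (jacDet_eq (hfd x hx) ▸ hdet x hx)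
  set g := Function.invFunOn f V
  have hg : ∀ w ∈ f '' V, g w ∈ V ∧ f (g w) = w := fun w hw =>
    ⟨Function.invFunOn_mem hw, Function.invFunOn_eq hw⟩
  have hgc : ∀ w ∈ f '' V, ContinuousAt g w := fun w hw => by
    obtain ⟨e, he⟩ := hequiv _ (hg w hw).1
    exact (hasFDerivAt_of_rightInvOn hV hinj hg hw e (he ▸ hfs _ (hg w hw).1)).continuousAt
  have hjc : ContinuousOn (jacDet f) V := by
    have hD := hf.continuousOn_fderiv_of_isOpen hV le_rfl
    have h1 : ContinuousOn (fun x => fderiv ℝ f x (1, 0)) V := hD.clm_apply continuousOn_const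
    have h2 : ContinuousOn (fun x => fderiv ℝ f x (0, 1)) V := hD.clm_apply continuousOn_const
    exact ((h1.fst.mul h2.snd).sub (h1.snd.mul h2.fst)).congr fun x hx => jacDet_eq (hfd x hx)
  set ζ : ℂ := ⟨(f z).1, (f z).2⟩ with hζ
  set c := ‖ζ‖ with hc
  set a := ζ.arg with ha
  have hc2 : c ^ 2 = (f z).1 ^ 2 + (f z).2 ^ 2 := by
    rw [hc, Complex.sq_norm, Complex.normSq_apply, hζ]
    ring
  have hcpos : 0 < c := by
    refine norm_pos_iff.2 fun h => hfz ?_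
    exact Prod.ext (congrArg Complex.re h) (congrArg Complex.im h)
  set ω : ℝ → ℝ × ℝ := fun θ => (c * cos (a + θ), c * sin (a + θ)) with hω
  have hωc : Continuous ω := by fun_prop
  have hω0 : ω 0 = f z := by
    simp only [hω, add_zero]
    exact Prod.ext (Complex.norm_mul_cos_arg ζ) (Complex.norm_mul_sin_arg ζ)
  have hωper : ∀ θ, ω (θ + 2 * π) = ω θ := fun θ => by
    simp only [hω, ← add_assoc, cos_add_two_pi, sin_add_two_pi]
  have hωV : ∀ θ, ω θ ∈ f '' V := fun θ => hcirc _ <| by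
    rw [← hc2]
    simp only [hω]
    linear_combination c ^ 2 * sin_sq_add_cos_sq (a + θ)
  have hωd : ∀ θ, HasDerivAt ω (-(ω θ).2, (ω θ).1) θ := fun θ => by
    have hl : HasDerivAt (fun θ => a + θ) 1 θ := (hasDerivAt_id θ).const_add a
    have := (hl.cos.const_mul c).prodMk (hl.sin.const_mul c)
    convert this using 1
    simp [hω]
  set h : ℝ → ℝ := fun θ => jacDet f (g (ω θ)) with hh
  have hhc : Continuous h := continuous_iff_continuousAt.2 fun θ =>
    ContinuousAt.comp (f := fun θ => g (ω θ))
      (hjc.continuousAt (hV.mem_nhds (hg _ (hωV θ)).1))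
      (ContinuousAt.comp (f := ω) (hgc _ (hωV θ)) hωc.continuousAt)
  obtain ⟨θ, hθ0, hθs, hθd, T, hT, hθT⟩ := exists_rotating_solution hhc
    (fun θ => hdet _ (hg _ (hωV θ)).1) two_pi_pos (fun θ => by simp only [hh, hωper])
  have hgz : g (ω 0) = z := by
    rw [hω0]
    exact hinj (hg _ ⟨z, hz, rfl⟩).1 hz (hg _ ⟨z, hz, rfl⟩).2
  refine ⟨fun t => g (ω (θ t)), ⟨fun t => (hg _ (hωV _)).1, fun t => ?_, ⟨T, hT, fun t => ?_⟩,
    ?_⟩, by simp only [hθ0, hgz]⟩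
  · obtain ⟨hpV, hpf⟩ := hg _ (hωV (θ t))
    obtain ⟨e, he⟩ := hequiv _ hpV
    have hgd := hasFDerivAt_of_rightInvOn hV hinj hg (hωV (θ t)) e (he ▸ hfs _ hpV)
    have hwd : HasDerivAt (fun t => ω (θ t)) _ t := (hωd (θ t)).scomp t (hθd t)
    have hX := fderiv_hamVF (hfd _ hpV)
    rw [hpf, ← he] at hX
    rw [← e.symm_apply_apply (hamVF f (g (ω (θ t))))]
    have hγ := hgd.comp_hasDerivAt t hwd
    exact (congrArg e.symm hX).symm ▸ hγ
  · have : ω (θ (t + T)) = ω (θ t) := by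
      rcases hθT with H | H
      · rw [H, hωper]
      · rw [H, ← hωper, sub_add_cancel]
    simp only [this]
  · obtain ⟨s, hs⟩ := hθs π
    refine ⟨s, 0, fun H => ?_⟩
    have H' : ω (θ s) = ω (θ 0) := by
      rw [← (hg _ (hωV (θ s))).2, ← (hg _ (hωV (θ 0))).2]
      exact congrArg f H
    rw [hs, hθ0] at H'
    have h1 := congrArg Prod.fst H'
    have h2 := congrArg Prod.snd H'
    simp only [hω, cos_add_pi, sin_add_pi, add_zero] at h1 h2
    have h3 : cos a = 0 := by nlinarith
    have h4 : sin a = 0 := by nlinarith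
    have := sin_sq_add_cos_sq a
    simp [h3, h4] at this

lemma IsPeriodicSolOn.mono {X : ℝ × ℝ → ℝ × ℝ} {S S' : Set (ℝ × ℝ)} {γ : ℝ → ℝ × ℝ}
    (h : IsPeriodicSolOn X S γ) (hS : S ⊆ S') : IsPeriodicSolOn X S' γ :=
  ⟨fun t => hS (h.1 t), h.2⟩

theorem good_set_inside_period_annulus (U : Set (ℝ × ℝ)) (hUo : IsOpen U)
    (hUc : IsConnected U) (f : ℝ × ℝ → ℝ × ℝ) (hf : ContDiffOn ℝ 2 f U)
    (hdet : ∀ z ∈ U, jacDet f z ≠ 0)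
    (z₀ : ℝ × ℝ) (hz₀ : z₀ ∈ U) (hfz : f z₀ = (0, 0))
    (V : Set (ℝ × ℝ)) (hVU : V ⊆ U) (hVo : IsOpen V) (hVc : IsConnected V)
    (hz₀V : z₀ ∈ V) (hinj : Set.InjOn f V)
    (him : f '' V = Set.univ ∨ ∃ r > 0, f '' V = disc r) :
    (∀ z ∈ V \ {z₀}, ∃ γ, IsPeriodicSolOn (hamVF f) V γ ∧ γ 0 = z) ∧
      ∀ W, IsPeriodAnnulus (hamVF f) U z₀ W → V ⊆ W := by
  have hper : ∀ z ∈ V \ {z₀}, ∃ γ, IsPeriodicSolOn (hamVF f) V γ ∧ γ 0 = z := by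
    rintro z ⟨hz, hzne⟩
    refine exists_periodicSol_of_circle_subset_image hVo
      ((hf.mono hVU).of_le one_le_two) (fun x hx => hdet x (hVU hx)) hinj hz
      (fun h => hzne (hinj hz hz₀V (h.trans hfz.symm))) fun w hw => ?_
    rcases him with h | ⟨r, -, h⟩
    · rw [h]
      trivial
    · have hzr : f z ∈ disc r := h ▸ mem_image_of_mem f hz
      rw [h]
      simpa only [disc, euclNorm, mem_ofPred_eq, hw] using hzr
  refine ⟨hper, ?_⟩
  rintro W ⟨hzW, hWU, hWo, hWc, hWper, hmax⟩
  have hunion : W ∪ V = W := by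
    refine hmax _ (Or.inl hzW) (union_subset hWU hVU) (hWo.union hVo)
      (hWc.union ⟨z₀, hzW, hz₀V⟩ hVc) ?_ subset_union_left
    rintro z ⟨hz | hz, hne⟩
    · obtain ⟨γ, hγ, h0⟩ := hWper z ⟨hz, hne⟩
      exact ⟨γ, hγ.mono subset_union_left, h0⟩
    · obtain ⟨γ, hγ, h0⟩ := hper z ⟨hz, hne⟩
      exact ⟨γ, hγ.mono subset_union_right, h0⟩
  exact union_eq_left.1 hunion
end

section
/- Let X : ℝ² → ℝ² be a polynomial vector field, z₀ ∈ ℝ² a singular point of X (X(z₀) = (0,0)), and W the period annulus of z₀: the maximal open connected set containing z₀ such that every point of W \ {z₀} lies on a periodic solution of X whose image is contained in W. Then the frontier ∂W of W is never a periodic orbit of X: there is no periodic solution γ of X whose image γ(ℝ) equals ∂W. -/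
open Real Set

open Filter Topology
open scoped ContDiff

/-- `w` is reached from `z` in time `T` (of either sign) along a solution of the vector field `X`
defined on an open interval containing `0` and `T`. -/
def Reach (X : ℝ × ℝ → ℝ × ℝ) (T : ℝ) (z w : ℝ × ℝ) : Prop :=
  ∃ (u : ℝ → ℝ × ℝ) (a b : ℝ), 0 ∈ Ioo a b ∧ T ∈ Ioo a b ∧
    (∀ t ∈ Ioo a b, HasDerivAt u (X (u t)) t) ∧ u 0 = z ∧ u T = w

section Reach

variable {X : ℝ × ℝ → ℝ × ℝ} {z w y : ℝ × ℝ} {S T a b : ℝ}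

lemma eqOn_Ioo_of_hasDerivAt (hX : ContDiff ℝ 1 X) {f g : ℝ → ℝ × ℝ} {t₀ : ℝ}
    (ht₀ : t₀ ∈ Ioo a b) (hf : ∀ t ∈ Ioo a b, HasDerivAt f (X (f t)) t)
    (hg : ∀ t ∈ Ioo a b, HasDerivAt g (X (g t)) t) (h : f t₀ = g t₀) : EqOn f g (Ioo a b) := by
  have hcf : ContinuousOn f (Ioo a b) := fun t ht ↦ (hf t ht).continuousAt.continuousWithinAt
  have hcg : ContinuousOn g (Ioo a b) := fun t ht ↦ (hg t ht).continuousAt.continuousWithinAt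
  have key : ∀ t ∈ Ioo a b, f t = g t → ∀ᶠ s in 𝓝 t, f s = g s := by
    intro t ht hfg
    obtain ⟨K, s, hs, hK⟩ := (hX.contDiffAt (x := f t)).exists_lipschitzOnWith
    have hI : Ioo a b ∈ 𝓝 t := Ioo_mem_nhds ht.1 ht.2
    refine ODE_solution_unique_of_eventually (v := fun _ ↦ X) (s := fun _ ↦ s) (K := K)
      (Eventually.of_forall fun _ ↦ hK) ?_ ?_ hfg
    · filter_upwards [hI, (hf t ht).continuousAt hs] with r hr hr' using ⟨hf r hr, hr'⟩
    · filter_upwards [hI, (hg t ht).continuousAt (hfg ▸ hs)] with r hr hr' using ⟨hg r hr, hr'⟩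
  have hsub : Ioo a b ⊆ {t | ∀ᶠ s in 𝓝 t, f s = g s} := by
    refine isPreconnected_Ioo.subset_of_closure_inter_subset isOpen_setOfPred_eventually_nhds
      ⟨t₀, ht₀, key t₀ ht₀ h⟩ ?_
    rintro t ⟨ht, htI⟩
    refine key t htI ?_
    have hfr : ∃ᶠ s in 𝓝 t, f s = g s :=
      (mem_closure_iff_frequently.1 ht).mono fun s hs ↦ hs.self_of_nhds
    have hcl : f t - g t ∈ closure ({0} : Set (ℝ × ℝ)) := by
      refine mem_closure_of_frequently_of_tendsto (f := fun s ↦ f s - g s) (b := 𝓝 t) ?_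
        ((hf t htI).continuousAt.sub (hg t htI).continuousAt)
      exact hfr.mono fun s hs ↦ by simp [hs]
    simpa [sub_eq_zero] using hcl
  exact fun t ht ↦ (hsub ht).self_of_nhds

lemma Reach.of_hasDerivAt {γ : ℝ → ℝ × ℝ} (hγ : ∀ t, HasDerivAt γ (X (γ t)) t) (s T : ℝ) :
    Reach X T (γ s) (γ (s + T)) := by
  refine ⟨fun t ↦ γ (s + t), min 0 T - 1, max 0 T + 1, ?_, ?_, fun t _ ↦ ?_, by simp, rfl⟩
  · constructor <;> [linarith [min_le_left 0 T]; linarith [le_max_left 0 T]]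
  · constructor <;> [linarith [min_le_right 0 T]; linarith [le_max_right 0 T]]
  · exact (hγ (s + t)).comp_const_add s t

lemma Reach.unique (hX : ContDiff ℝ 1 X) (h : Reach X T z w) (h' : Reach X T z y) : w = y := by
  obtain ⟨u, a, b, h0, hT, hu, rfl, rfl⟩ := h
  obtain ⟨v, a', b', h0', hT', hv, hv0, rfl⟩ := h'
  exact eqOn_Ioo_of_hasDerivAt hX (a := max a a') (b := min b b') (t₀ := 0)
    ⟨max_lt h0.1 h0'.1, lt_min h0.2 h0'.2⟩
    (fun t ht ↦ hu t ⟨(le_max_left _ _).trans_lt ht.1, ht.2.trans_le (min_le_left _ _)⟩)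
    (fun t ht ↦ hv t ⟨(le_max_right _ _).trans_lt ht.1, ht.2.trans_le (min_le_right _ _)⟩)
    hv0.symm ⟨max_lt hT.1 hT'.1, lt_min hT.2 hT'.2⟩

lemma Reach.eq_of_hasDerivAt (hX : ContDiff ℝ 1 X) {γ : ℝ → ℝ × ℝ}
    (hγ : ∀ t, HasDerivAt γ (X (γ t)) t) {s : ℝ} (h : Reach X T (γ s) w) : w = γ (s + T) :=
  h.unique hX (.of_hasDerivAt hγ s T)

lemma Reach.symm (h : Reach X T z w) : Reach X (-T) w z := by
  obtain ⟨u, a, b, h0, hT, hu, rfl, rfl⟩ := h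
  refine ⟨fun t ↦ u (T + t), a - T, b - T, ?_, ?_, fun t ht ↦ ?_, by simp, by simp⟩
  · constructor <;> linarith [hT.1, hT.2]
  · constructor <;> linarith [h0.1, h0.2]
  · exact (hu (T + t) ⟨by linarith [ht.1], by linarith [ht.2]⟩).comp_const_add T t

lemma Reach.trans (hX : ContDiff ℝ 1 X) (h : Reach X S z w) (h' : Reach X T w y) :
    Reach X (S + T) z y := by
  obtain ⟨u, a, b, h0, hS, hu, rfl, rfl⟩ := h
  obtain ⟨v, c, d, h0', hT, hv, hv0, rfl⟩ := h'
  have hv' : ∀ t ∈ Ioo (c + S) (d + S), HasDerivAt (fun t ↦ v (t - S)) (X (v (t - S))) t :=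
    fun t ht ↦ (hv (t - S) ⟨by linarith [ht.1], by linarith [ht.2]⟩).comp_sub_const t S
  have heq : EqOn u (fun t ↦ v (t - S)) (Ioo (max a (c + S)) (min b (d + S))) :=
    eqOn_Ioo_of_hasDerivAt hX (t₀ := S)
      ⟨max_lt hS.1 (by linarith [h0'.1]), lt_min hS.2 (by linarith [h0'.2])⟩
      (fun t ht ↦ hu t ⟨(le_max_left _ _).trans_lt ht.1, ht.2.trans_le (min_le_left _ _)⟩)
      (fun t ht ↦ hv' t ⟨(le_max_right _ _).trans_lt ht.1, ht.2.trans_le (min_le_right _ _)⟩)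
      (by simp [hv0])
  classical
  let g : ℝ → ℝ × ℝ := fun t ↦ if t ∈ Ioo a b then u t else v (t - S)
  have hgu : EqOn g u (Ioo a b) := fun t ht ↦ if_pos ht
  have hgv : EqOn g (fun t ↦ v (t - S)) (Ioo (c + S) (d + S)) := by
    intro t ht
    by_cases h : t ∈ Ioo a b
    · exact (hgu h).trans (heq ⟨max_lt h.1 ht.1, lt_min h.2 ht.2⟩)
    · exact if_neg h
  have hST : S + T ∈ Ioo (c + S) (d + S) := ⟨by linarith [hT.1], by linarith [hT.2]⟩
  refine ⟨g, min a (c + S), max b (d + S), ⟨min_lt_of_left_lt h0.1, lt_max_of_lt_left h0.2⟩,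
    ⟨min_lt_of_right_lt hST.1, lt_max_of_lt_right hST.2⟩, ?_, hgu h0, ?_⟩
  · intro t ht
    have : t ∈ Ioo a b ∨ t ∈ Ioo (c + S) (d + S) := by
      obtain ⟨h1, h2⟩ := ht
      simp only [mem_Ioo]
      rcases min_lt_iff.1 h1 with h1 | h1 <;> rcases lt_max_iff.1 h2 with h2 | h2
      · exact .inl ⟨h1, h2⟩
      · by_cases h3 : t < b
        · exact .inl ⟨h1, h3⟩
        · exact .inr ⟨by linarith [h0'.1, hS.2], h2⟩
      · by_cases h3 : a < t
        · exact .inl ⟨h3, h2⟩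
        · exact .inr ⟨h1, by linarith [h0'.2, hS.1]⟩
      · exact .inr ⟨h1, h2⟩
    rcases this with h | h
    · rw [hgu h]
      exact (hu t h).congr_of_eventuallyEq (hgu.eventuallyEq_of_mem (Ioo_mem_nhds h.1 h.2))
    · rw [hgv h]
      exact (hv' t h).congr_of_eventuallyEq (hgv.eventuallyEq_of_mem (Ioo_mem_nhds h.1 h.2))
  · simpa using hgv hST

lemma Reach.zero (hX : ContDiff ℝ 1 X) (z : ℝ × ℝ) : Reach X 0 z z := by
  obtain ⟨u, hu0, ε, hε, hu⟩ :=
    (hX.contDiffAt (x := z)).exists_forall_mem_closedBall_exists_eq_forall_mem_Ioo_hasDerivAt₀ 0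
  exact ⟨u, 0 - ε, 0 + ε, by simpa using hε, by simpa using hε, hu, hu0, hu0⟩

/-- A solution returning to its starting point extends to a periodic solution. -/
lemma Reach.exists_periodic (hX : ContDiff ℝ 1 X) (h : Reach X T z z) (hT : T ≠ 0) :
    ∃ γ : ℝ → ℝ × ℝ, (∀ t, HasDerivAt γ (X (γ t)) t) ∧ (∃ T > 0, ∀ t, γ (t + T) = γ t) ∧
      γ 0 = z := by
  wlog hpos : 0 < T generalizing T
  · exact this h.symm (neg_ne_zero.2 hT) (by grind)
  obtain ⟨u, a, b, h0, hT', hu, rfl, huT⟩ := h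
  have hper : ∀ t ∈ Ioo a (b - T), u (t + T) = u t := by
    have := eqOn_Ioo_of_hasDerivAt hX (a := a) (b := b - T) (t₀ := 0) (f := fun t ↦ u (t + T))
      (g := u) ⟨h0.1, by linarith [hT'.2]⟩
      (fun t ht ↦ (hu (t + T) ⟨by linarith [ht.1], by linarith [ht.2]⟩).comp_add_const t T)
      (fun t ht ↦ hu t ⟨ht.1, by linarith [ht.2]⟩) (by simpa using huT)
    exact this
  let γ : ℝ → ℝ × ℝ := fun t ↦ u (toIcoMod hpos 0 t)
  have hγper : ∀ t, γ (t + T) = γ t := fun t ↦ by simp [γ]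
  have hγu : ∀ t ∈ Ioo (max a (-T)) T, γ t = u t := by
    intro t ht
    by_cases h : 0 ≤ t
    · have : toIcoMod hpos 0 t = t := (toIcoMod_eq_self hpos).2 ⟨h, by simpa using ht.2⟩
      simp [γ, this]
    · have h2 := (max_lt_iff.1 ht.1)
      have : toIcoMod hpos 0 (t + T) = t + T :=
        (toIcoMod_eq_self hpos).2 ⟨by linarith, by linarith⟩
      rw [← hγper, ← hper t ⟨h2.1, by linarith [hT'.2]⟩]
      simp only [γ, this]
  refine ⟨γ, fun t ↦ ?_, ⟨T, hpos, hγper⟩, ?_⟩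
  · have hmem : toIcoMod hpos 0 t ∈ Ioo (max a (-T)) T := by
      have := toIcoMod_mem_Ico hpos 0 t
      simp only [zero_add] at this
      exact ⟨(max_lt h0.1 (by linarith)).trans_le this.1, this.2⟩
    set r := toIcoMod hpos 0 t with hr
    have h1 : HasDerivAt γ (X (γ t)) r := by
      have h2 : γ t = u r := rfl
      rw [h2]
      refine (hu r ⟨(le_max_left _ _).trans_lt hmem.1, hmem.2.trans hT'.2⟩).congr_of_eventuallyEq ?_
      exact (show EqOn γ u _ from hγu).eventuallyEq_of_mem (Ioo_mem_nhds hmem.1 hmem.2)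
    have h3 : γ = fun x ↦ γ (x - toIcoDiv hpos 0 t • T) := by
      funext x; simp [γ]
    rw [h3]
    have h4 : r = t - toIcoDiv hpos 0 t • T := rfl
    rw [h4] at h1
    have h5 := h1.comp_sub_const t (toIcoDiv hpos 0 t • T)
    rwa [show γ t = γ (t - toIcoDiv hpos 0 t • T) from congrFun h3 t] at h5
  · exact hγu 0 ⟨max_lt h0.1 (by linarith), hpos⟩

end Reach

lemma neg_two_le_two_real : (-2 : ℝ) ≤ 2 := by norm_num

/-- The primitive vanishing at `0` of a continuous function on `[-2, 2]`. -/
noncomputable def primitive (u : C(Icc (-2 : ℝ) 2, ℝ)) : C(Icc (-2 : ℝ) 2, ℝ) where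
  toFun t := ∫ s in (0 : ℝ)..t, IccExtend neg_two_le_two_real u s
  continuous_toFun := (intervalIntegral.continuous_primitive (fun _ _ ↦
    (u.continuous.Icc_extend' (h := neg_two_le_two_real)).intervalIntegrable _ _) 0).comp
      continuous_subtype_val

lemma norm_primitive_le (u : C(Icc (-2 : ℝ) 2, ℝ)) : ‖primitive u‖ ≤ 2 * ‖u‖ := by
  refine (ContinuousMap.norm_le _ (by positivity)).2 fun t ↦ ?_
  have h := intervalIntegral.norm_integral_le_of_norm_le_const (a := (0 : ℝ)) (b := t)
    (f := IccExtend neg_two_le_two_real u) (C := ‖u‖) fun s _ ↦ u.norm_coe_le_norm _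
  refine h.trans ?_
  rw [mul_comm, sub_zero]
  gcongr
  exact abs_le.2 t.2

/-- Integration from `0`, as a continuous linear operator on continuous functions on `[-2, 2]`. -/
noncomputable def integralCLM : C(Icc (-2 : ℝ) 2, ℝ) →L[ℝ] C(Icc (-2 : ℝ) 2, ℝ) :=
  LinearMap.mkContinuous
    { toFun := primitive
      map_add' := fun u v ↦ by
        ext t
        exact intervalIntegral.integral_add
          ((u.continuous.Icc_extend' (h := neg_two_le_two_real)).intervalIntegrable _ _)
          ((v.continuous.Icc_extend' (h := neg_two_le_two_real)).intervalIntegrable _ _)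
      map_smul' := fun c u ↦ by
        ext t
        exact intervalIntegral.integral_smul c _ } 2 norm_primitive_le

lemma contDiff_aeval {A B : Type*} [NormedAddCommGroup B] [NormedSpace ℝ B] [NormedCommRing A]
    [NormedAlgebra ℝ A] {n : ℕ∞ω} {σ : Type*} {f : B → σ → A}
    (hf : ∀ i, ContDiff ℝ n fun b ↦ f b i) (p : MvPolynomial σ ℝ) :
    ContDiff ℝ n fun b ↦ MvPolynomial.aeval (f b) p := by
  induction p using MvPolynomial.induction_on with
  | C a => simpa using contDiff_const
  | add p q hp hq => simpa using hp.add hq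
  | mul_X p i hp => simpa using hp.mul (hf i)

lemma aeval_continuousMap_apply {K σ : Type*} [TopologicalSpace K] (f : σ → C(K, ℝ))
    (p : MvPolynomial σ ℝ) (t : K) :
    MvPolynomial.aeval f p t = MvPolynomial.eval (fun i ↦ f i t) p := by
  induction p using MvPolynomial.induction_on with
  | C a => simp
  | add p q hp hq => simp [hp, hq]
  | mul_X p i hp => simp [hp]

lemma contDiff_of_polynomial {X : ℝ × ℝ → ℝ × ℝ} {p q : MvPolynomial (Fin 2) ℝ}
    (hX : ∀ z : ℝ × ℝ,
      X z = (MvPolynomial.eval ![z.1, z.2] p, MvPolynomial.eval ![z.1, z.2] q)) {n : ℕ∞ω} :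
    ContDiff ℝ n X := by
  have h : ∀ i, ContDiff ℝ n fun z : ℝ × ℝ ↦ ![z.1, z.2] i := by
    intro i; fin_cases i
    · exact contDiff_fst
    · exact contDiff_snd
  rw [funext hX]
  exact (by simpa using contDiff_aeval h p : ContDiff ℝ n _).prodMk
    (by simpa using contDiff_aeval h q)

/-- The local flow of a polynomial vector field is jointly analytic in time and initial value. -/
lemma exists_analytic_local_flow {X : ℝ × ℝ → ℝ × ℝ}
    (hX : ∃ p q : MvPolynomial (Fin 2) ℝ, ∀ z : ℝ × ℝ,
      X z = (MvPolynomial.eval ![z.1, z.2] p, MvPolynomial.eval ![z.1, z.2] q)) (z₀ : ℝ × ℝ) :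
    ∃ φ : ℝ × (ℝ × ℝ) → ℝ × ℝ, ContDiffAt ℝ ω φ (0, z₀) ∧
      ∀ᶠ x in 𝓝 ((0 : ℝ), z₀), Reach X x.1 x.2 (φ x) := by
  obtain ⟨p, q, hX⟩ := hX
  have hXc : ContDiff ℝ 1 X := contDiff_of_polynomial hX
  let E := C(Icc (-2 : ℝ) 2, ℝ)
  let c : ℝ →L[ℝ] E := ContinuousLinearMap.const ℝ (Icc (-2 : ℝ) 2)
  let Y : MvPolynomial (Fin 2) ℝ → E × E → E := fun r u ↦ MvPolynomial.aeval ![u.1, u.2] r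
  have hY : ∀ r, ContDiff ℝ ω (Y r) := fun r ↦ by
    refine contDiff_aeval (fun i ↦ ?_) r
    fin_cases i
    · exact contDiff_fst
    · exact contDiff_snd
  have hYt : ∀ r u t, Y r u t = MvPolynomial.eval ![u.1 t, u.2 t] r := fun r u t ↦ by
    rw [aeval_continuousMap_apply]
    congr 2
    funext i; fin_cases i <;> rfl
  let F : (ℝ × (ℝ × ℝ)) × (E × E) → E × E := fun v ↦
    (v.2.1 - c v.1.2.1 - v.1.1 • integralCLM (Y p v.2),
      v.2.2 - c v.1.2.2 - v.1.1 • integralCLM (Y q v.2))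
  have hF : ContDiff ℝ ω F := by
    have h : ∀ r, ContDiff ℝ ω fun v : (ℝ × (ℝ × ℝ)) × (E × E) ↦
        v.1.1 • integralCLM (Y r v.2) := fun r ↦
      (contDiff_fst.comp contDiff_fst).smul (integralCLM.contDiff.comp ((hY r).comp contDiff_snd))
    refine ContDiff.prodMk ?_ ?_
    · refine ContDiff.sub (ContDiff.sub ?_ (c.contDiff.comp ?_)) (h p) <;> fun_prop
    · refine ContDiff.sub (ContDiff.sub ?_ (c.contDiff.comp ?_)) (h q) <;> fun_prop
  let u₀ : E × E := (c z₀.1, c z₀.2)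
  let v₀ : (ℝ × (ℝ × ℝ)) × (E × E) := ((0, z₀), u₀)
  have hFv₀ : F v₀ = 0 := by simp [F, v₀, u₀]
  have hinv : (fderiv ℝ F v₀ ∘L .inr ℝ (ℝ × (ℝ × ℝ)) (E × E)).IsInvertible := by
    have h1 : HasFDerivAt (fun u : E × E ↦ F ((0, z₀), u))
        (fderiv ℝ F v₀ ∘L .inr ℝ (ℝ × (ℝ × ℝ)) (E × E)) u₀ :=
      ((hF.differentiable (by simp)).differentiableAt (x := v₀)).hasFDerivAt.comp u₀
        (hasFDerivAt_prodMk_right (0, z₀) u₀)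
    have h2 : (fun u : E × E ↦ F ((0, z₀), u)) = fun u ↦ u - u₀ := by
      funext u; simp [F, u₀]; rfl
    have h3 : HasFDerivAt (fun u : E × E ↦ u - u₀) (.id ℝ (E × E)) u₀ :=
      (hasFDerivAt_id u₀).sub_const u₀
    rw [h2] at h1
    rw [h1.unique h3]
    exact ⟨.refl ℝ _, rfl⟩
  have hFa : ContDiffAt ℝ ω F v₀ := hF.contDiffAt
  have hω : (ω : ℕ∞ω) ≠ 0 := by simp
  let ψ := hFa.implicitFunction hω hinv
  have hψ : ContDiffAt ℝ ω ψ (0, z₀) := hFa.contDiffAt_implicitFunction hω hinv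
  have hFψ : ∀ᶠ x in 𝓝 ((0 : ℝ), z₀), F (x, ψ x) = 0 :=
    hFv₀ ▸ hFa.eventually_apply_implicitFunction hω hinv
  let one : Icc (-2 : ℝ) 2 := ⟨1, by norm_num⟩
  let ev : E →L[ℝ] ℝ := ContinuousMap.evalCLM ℝ one
  refine ⟨fun x ↦ (ev (ψ x).1, ev (ψ x).2),
    (ev.contDiff.contDiffAt.comp _ hψ.fst).prodMk (ev.contDiff.contDiffAt.comp _ hψ.snd), ?_⟩
  filter_upwards [hFψ] with x hx
  obtain ⟨l, z⟩ := x
  set u := ψ (l, z)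
  have hu1 : ∀ t, u.1 t = z.1 + l * integralCLM (Y p u) t := fun t ↦ by
    have h : u.1 t - z.1 - l * integralCLM (Y p u) t = 0 :=
      DFunLike.congr_fun (congrArg Prod.fst hx) t
    linarith
  have hu2 : ∀ t, u.2 t = z.2 + l * integralCLM (Y q u) t := fun t ↦ by
    have h : u.2 t - z.2 - l * integralCLM (Y q u) t = 0 :=
      DFunLike.congr_fun (congrArg Prod.snd hx) t
    linarith
  rcases eq_or_ne l 0 with rfl | hl
  · have : (ev u.1, ev u.2) = z := by
      ext
      · exact (hu1 one).trans (by simp)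
      · exact (hu2 one).trans (by simp)
    show Reach X 0 z (ev u.1, ev u.2)
    rw [this]
    exact Reach.zero hXc z
  let U : ℝ → ℝ × ℝ := fun t ↦
    (z.1 + l * ∫ s in (0 : ℝ)..t, IccExtend neg_two_le_two_real (Y p u) s,
      z.2 + l * ∫ s in (0 : ℝ)..t, IccExtend neg_two_le_two_real (Y q u) s)
  have hUu : ∀ t : Icc (-2 : ℝ) 2, U t = (u.1 t, u.2 t) := fun t ↦ by
    rw [hu1, hu2]; rfl
  have hU : ∀ t ∈ Ioo (-2 : ℝ) 2, HasDerivAt U (l • X (U t)) t := by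
    intro t ht
    have ht' : t ∈ Icc (-2 : ℝ) 2 := Ioo_subset_Icc_self ht
    have hr : ∀ (r : MvPolynomial (Fin 2) ℝ) (a : ℝ), HasDerivAt
        (fun t ↦ a + l * ∫ s in (0 : ℝ)..t, IccExtend neg_two_le_two_real (Y r u) s)
        (l * MvPolynomial.eval ![(U t).1, (U t).2] r) t := by
      intro r a
      have h := ((Y r u).continuous.Icc_extend'
        (h := neg_two_le_two_real)).integral_hasStrictDerivAt 0 t
      have h' := (h.hasDerivAt.const_mul l).const_add a
      rw [IccExtend_of_mem _ _ ht'] at h'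
      rw [hUu ⟨t, ht'⟩, ← hYt]
      exact h'
    rw [hX]
    exact (hr p z.1).prodMk (hr q z.2)
  have hlpos : 0 < |l| := abs_pos.2 hl
  refine ⟨fun t ↦ U (l⁻¹ * t), -(2 * |l|), 2 * |l|, ⟨by simpa, by positivity⟩, ?_, ?_, ?_, ?_⟩
  · exact abs_lt.1 (by linarith)
  · intro t ht
    have h1 : l⁻¹ * t ∈ Ioo (-2 : ℝ) 2 := by
      have := abs_lt.2 ht
      refine abs_lt.1 ?_
      rw [abs_mul, abs_inv, inv_mul_lt_iff₀ hlpos]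
      linarith
    have h2 := (hU _ h1).scomp t ((hasDerivAt_id t).const_mul l⁻¹)
    rw [smul_smul, mul_one, inv_mul_cancel₀ hl, one_smul] at h2
    exact h2
  · simp [U]
  · have : l⁻¹ * l = (one : ℝ) := by simp [hl, one]
    simp only [this]
    exact hUu one

section ReturnMap

variable {X : ℝ × ℝ → ℝ × ℝ} {γ : ℝ → ℝ × ℝ} {v : ℝ × ℝ}

/-- Along a global solution, the time-`T` map is defined and analytic near the initial point. -/
lemma exists_analytic_time_map
    (hX : ∃ p q : MvPolynomial (Fin 2) ℝ, ∀ z : ℝ × ℝ,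
      X z = (MvPolynomial.eval ![z.1, z.2] p, MvPolynomial.eval ![z.1, z.2] q))
    (hγ : ∀ t, HasDerivAt γ (X (γ t)) t) (T : ℝ) :
    ∃ G : ℝ × ℝ → ℝ × ℝ, ContDiffAt ℝ ω G (γ 0) ∧ ∀ᶠ z in 𝓝 (γ 0), Reach X T z (G z) := by
  have hXc : ContDiff ℝ 1 X := by
    obtain ⟨p, q, hX⟩ := hX
    exact contDiff_of_polynomial hX
  have hγc : Continuous γ := continuous_iff_continuousAt.2 fun t ↦ (hγ t).continuousAt
  let A : ℝ → ℝ → Prop := fun s t ↦ ∃ G : ℝ × ℝ → ℝ × ℝ, ContDiffAt ℝ ω G (γ s) ∧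
    ∀ᶠ z in 𝓝 (γ s), Reach X (t - s) z (G z)
  have hAG : ∀ {s t : ℝ} {G : ℝ × ℝ → ℝ × ℝ},
      (∀ᶠ z in 𝓝 (γ s), Reach X (t - s) z (G z)) → G (γ s) = γ t := fun {s t G} h ↦ by
    simpa using h.self_of_nhds.eq_of_hasDerivAt hXc hγ
  have htrans : ∀ {r s t}, A r s → A s t → A r t := by
    rintro r s t ⟨G, hG, hGr⟩ ⟨H, hH, hHr⟩
    have hGs := hAG hGr
    refine ⟨H ∘ G, ContDiffAt.comp _ (hGs ▸ hH) hG, ?_⟩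
    filter_upwards [hGr, hG.continuousAt.eventually (hGs ▸ hHr)] with z h1 h2
    simpa using h1.trans hXc h2
  have hloc : ∀ t, ∀ᶠ s in 𝓝 t, A t s ∧ A s t := by
    intro t
    obtain ⟨φ, hφ, hφr⟩ := exists_analytic_local_flow hX (γ t)
    have hev : ∀ᶠ x in 𝓝 ((0 : ℝ), γ t), ContDiffAt ℝ ω φ x ∧
        ∀ᶠ y in 𝓝 x, Reach X y.1 y.2 (φ y) :=
      (hφ.eventually (by simp)).and hφr.eventually_nhds
    have hA : ∀ r s, (ContDiffAt ℝ ω φ (s - r, γ r) ∧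
        ∀ᶠ y in 𝓝 (s - r, γ r), Reach X y.1 y.2 (φ y)) → A r s := by
      rintro r s ⟨h1, h2⟩
      refine ⟨fun z ↦ φ (s - r, z), h1.comp _ (contDiffAt_const.prodMk contDiffAt_id), ?_⟩
      exact (Continuous.prodMk_right (s - r)).continuousAt.eventually h2
    have c1 : Tendsto (fun s ↦ (s - t, γ t)) (𝓝 t) (𝓝 (0, γ t)) := by
      have : Continuous fun s ↦ (s - t, γ t) := by fun_prop
      simpa using this.tendsto t
    have c2 : Tendsto (fun s ↦ (t - s, γ s)) (𝓝 t) (𝓝 (0, γ t)) := by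
      have : Continuous fun s ↦ (t - s, γ s) := by fun_prop
      simpa using this.tendsto t
    filter_upwards [c1.eventually hev, c2.eventually hev] with s h1 h2 using ⟨hA _ _ h1, hA _ _ h2⟩
  have hclopen : IsClopen {t | A 0 t} := by
    refine ⟨isClosed_of_closure_subset fun t ht ↦ ?_, isOpen_iff_mem_nhds.2 fun t ht ↦ ?_⟩
    · obtain ⟨s, hs, hs'⟩ := ((mem_closure_iff_frequently.1 ht).and_eventually (hloc t)).exists
      exact htrans hs hs'.2
    · filter_upwards [hloc t] with s hs using htrans ht hs.1
  have huniv := hclopen.eq_univ ⟨0, htrans (hloc 0).self_of_nhds.1 (hloc 0).self_of_nhds.1⟩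
  have hT : A 0 T := by
    have : T ∈ {t | A 0 t} := huniv ▸ mem_univ T
    exact this
  simpa [A] using hT

/-- Projection along the flow to the line orthogonal to the vector field. -/
lemma exists_analytic_projection
    (hX : ∃ p q : MvPolynomial (Fin 2) ℝ, ∀ z : ℝ × ℝ,
      X z = (MvPolynomial.eval ![z.1, z.2] p, MvPolynomial.eval ![z.1, z.2] q))
    (hγ : ∀ t, HasDerivAt γ (X (γ t)) t) (h0 : X (γ 0) ≠ 0) (hv : v ≠ 0)
    (hvX : v.1 * (X (γ 0)).1 + v.2 * (X (γ 0)).2 = 0) :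
    ∃ σ c : ℝ × ℝ → ℝ, ContDiffAt ℝ ω σ (γ 0) ∧ σ (γ 0) = 0 ∧
      ContDiffAt ℝ ω c (γ 0) ∧ c (γ 0) = 0 ∧
      (∀ᶠ z in 𝓝 (γ 0), Reach X (σ z) z (γ 0 + c z • v)) ∧
      ∀ᶠ x in 𝓝 ((0 : ℝ), γ 0), x.2 - γ 0 ∈ Submodule.span ℝ {v} → ∀ s : ℝ,
        Reach X x.1 x.2 (γ 0 + s • v) → x.1 = 0 := by
  have hXc : ContDiff ℝ 1 X := by
    obtain ⟨p, q, hX⟩ := hX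
    exact contDiff_of_polynomial hX
  set p := γ 0 with hp
  obtain ⟨φ, hφ, hφr⟩ := exists_analytic_local_flow hX p
  have sq_pos : ∀ w : ℝ × ℝ, w ≠ 0 → 0 < w.1 * w.1 + w.2 * w.2 := by
    intro w hw
    by_contra! h
    exact hw (Prod.ext (by simp; nlinarith [mul_self_nonneg w.1, mul_self_nonneg w.2])
      (by simp; nlinarith [mul_self_nonneg w.1, mul_self_nonneg w.2]))
  let dot : ℝ × ℝ → (ℝ × ℝ →L[ℝ] ℝ) := fun a ↦
    a.1 • ContinuousLinearMap.fst ℝ ℝ ℝ + a.2 • ContinuousLinearMap.snd ℝ ℝ ℝ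
  have hdot : ∀ a w, dot a w = a.1 * w.1 + a.2 * w.2 := fun a w ↦ by simp [dot]
  have hXX := sq_pos _ h0
  have hvv := sq_pos _ hv
  have hdv : dot (X p) v = 0 := by rw [hdot]; linarith
  have hdecomp : ∀ w, dot (X p) w = 0 → w = (dot v w / dot v v) • v := by
    intro w hw
    rw [hdot] at hw
    have h1 : v.1 * w.2 = v.2 * w.1 := by
      have e1 : (X p).1 * (v.1 * w.2 - v.2 * w.1) = 0 := by
        linear_combination w.2 * hvX - v.2 * hw
      have e2 : (X p).2 * (v.1 * w.2 - v.2 * w.1) = 0 := by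
        linear_combination v.1 * hw - w.1 * hvX
      rcases mul_eq_zero.1 e1 with h | h
      · rcases mul_eq_zero.1 e2 with h' | h'
        · rw [h, h'] at hXX; simp at hXX
        · linarith
      · linarith
    have hvv' := hvv.ne'
    rw [hdot, hdot]
    ext
    · simp only [Prod.smul_fst, smul_eq_mul]
      rw [div_mul_eq_mul_div, eq_div_iff hvv']
      linear_combination -v.2 * h1
    · simp only [Prod.smul_snd, smul_eq_mul]
      rw [div_mul_eq_mul_div, eq_div_iff hvv']
      linear_combination v.1 * h1
  let f : (ℝ × ℝ) × ℝ → ℝ := fun x ↦ dot (X p) (φ (x.2, x.1) - p)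
  have hφ0 : φ (0, p) = p := by
    simpa using (hφr.self_of_nhds.eq_of_hasDerivAt hXc hγ)
  have hf0 : f (p, 0) = 0 := by simp [f, hφ0]
  have hf : ContDiffAt ℝ ω f (p, 0) := by
    refine (dot (X p)).contDiff.contDiffAt.comp _ (ContDiffAt.sub ?_ contDiffAt_const)
    exact ContDiffAt.comp (f := fun x : (ℝ × ℝ) × ℝ ↦ (x.2, x.1)) (p, (0 : ℝ)) hφ
      (contDiffAt_snd.prodMk contDiffAt_fst)
  have hω : (ω : ℕ∞ω) ≠ 0 := by simp
  have hinv : (fderiv ℝ f (p, 0) ∘L .inr ℝ (ℝ × ℝ) ℝ).IsInvertible := by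
    have h1 : HasFDerivAt (fun t : ℝ ↦ f (p, t)) (fderiv ℝ f (p, 0) ∘L .inr ℝ (ℝ × ℝ) ℝ) 0 :=
      (hf.differentiableAt hω).hasFDerivAt.comp (0 : ℝ) (hasFDerivAt_prodMk_right p (0 : ℝ))
    have h2 : (fun t : ℝ ↦ f (p, t)) =ᶠ[𝓝 0] fun t ↦ dot (X p) (γ t - p) := by
      have hc : ContinuousAt (fun t : ℝ ↦ (t, p)) 0 := by fun_prop
      filter_upwards [hc.eventually hφr] with t ht
      have : φ (t, p) = γ t := by simpa using ht.eq_of_hasDerivAt hXc hγ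
      simp [f, this]
    have h3 : HasDerivAt (fun t ↦ dot (X p) (γ t - p)) (dot (X p) (X p)) 0 :=
      (dot (X p)).hasFDerivAt.comp_hasDerivAt (0 : ℝ) ((hγ 0).sub_const p)
    have h4 := h1.unique (h3.hasFDerivAt.congr_of_eventuallyEq h2)
    rw [h4]
    have hne : dot (X p) (X p) ≠ 0 := by rw [hdot]; exact hXX.ne'
    refine ⟨ContinuousLinearEquiv.unitsEquivAut ℝ (Units.mk0 _ hne), ?_⟩
    ext
    simp
  let σ := hf.implicitFunction hω hinv
  have hσ : ContDiffAt ℝ ω σ p := hf.contDiffAt_implicitFunction hω hinv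
  have hσ0 : σ p = 0 := hf.implicitFunction_apply_self hω hinv
  have hfσ : ∀ᶠ z in 𝓝 p, f (z, σ z) = 0 := by
    have := hf.eventually_apply_implicitFunction hω hinv
    simpa only [hf0] using this
  have huniq : ∀ᶠ x in 𝓝 (p, (0 : ℝ)), f x = 0 ↔ σ x.1 = x.2 := by
    have := hf.eventually_apply_eq_iff_implicitFunction hω hinv
    simpa only [hf0] using this
  have hφσ : ContDiffAt ℝ ω (fun z ↦ φ (σ z, z)) p :=
    ContDiffAt.comp (f := fun z ↦ (σ z, z)) p (by rwa [hσ0]) (hσ.prodMk contDiffAt_id)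
  refine ⟨σ, fun z ↦ dot v (φ (σ z, z) - p) / dot v v, hσ, hσ0, ?_, by simp [hσ0, hφ0], ?_, ?_⟩
  · exact ((dot v).contDiff.contDiffAt.comp p (hφσ.sub contDiffAt_const)).div_const _
  · have hc : Tendsto (fun z ↦ (σ z, z)) (𝓝 p) (𝓝 (0, p)) := by
      simpa [hσ0] using (hσ.continuousAt.prodMk continuousAt_id).tendsto
    filter_upwards [hfσ, hc.eventually hφr] with z h1 h2
    rw [← hdecomp _ h1]
    simpa using h2
  · have hc1 : Tendsto (fun x : ℝ × (ℝ × ℝ) ↦ (x.2, x.1)) (𝓝 (0, p)) (𝓝 (p, 0)) :=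
      continuous_swap.tendsto (0, p)
    have hc2 : Tendsto (fun x : ℝ × (ℝ × ℝ) ↦ (x.2, (0 : ℝ))) (𝓝 (0, p)) (𝓝 (p, 0)) :=
      (by fun_prop : Continuous fun x : ℝ × (ℝ × ℝ) ↦ (x.2, (0 : ℝ))).tendsto (0, p)
    have hc3 : Tendsto (fun x : ℝ × (ℝ × ℝ) ↦ ((0 : ℝ), x.2)) (𝓝 (0, p)) (𝓝 (0, p)) :=
      (by fun_prop : Continuous fun x : ℝ × (ℝ × ℝ) ↦ ((0 : ℝ), x.2)).tendsto (0, p)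
    filter_upwards [hφr, hc3.eventually hφr, hc1.eventually huniq, hc2.eventually huniq]
      with x h1 h2 h3 h4 hx s hs
    obtain ⟨r, hr⟩ := Submodule.mem_span_singleton.1 hx
    have e1 : σ x.2 = x.1 := h3.1 (by simp [f, h1.unique hXc hs, hdv])
    have e2 : σ x.2 = 0 := h4.1 (by
      simp only [f, h2.unique hXc (Reach.zero hXc x.2), ← hr, map_smul, hdv, smul_zero])
    exact e1.symm.trans e2

end ReturnMap

lemma ContDiffAt.exists_strictMonoOn_ball {Q : ℝ → ℝ} {a x : ℝ} (hQ : ContDiffAt ℝ 1 Q x)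
    (h : HasDerivAt Q a x) (ha : 0 < a) : ∃ ε > 0, StrictMonoOn Q (Metric.ball x ε) := by
  have hc : ContinuousAt (deriv Q) x := by
    have h1 : ContinuousAt (fun y ↦ fderiv ℝ Q y 1) x :=
      (hQ.continuousAt_fderiv one_ne_zero).clm_apply continuousAt_const
    simpa only [fderiv_apply_one_eq_deriv] using h1
  have hpos : ∀ᶠ y in 𝓝 x, 0 < deriv Q y ∧ ContDiffAt ℝ 1 Q y :=
    (hc.eventually (lt_mem_nhds (by rwa [h.deriv]))).and (hQ.eventually (by simp))
  obtain ⟨ε, hε, hball⟩ := Metric.eventually_nhds_iff_ball.1 hpos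
  refine ⟨ε, hε, strictMonoOn_of_deriv_pos (convex_ball x ε)
    (fun y hy ↦ (hball y hy).2.continuousAt.continuousWithinAt) fun y hy ↦ ?_⟩
  exact (hball y (interior_subset hy)).1

/-- If `P` is an analytic germ with inverse `R`, and there are arbitrarily small positive points
moved left by neither `P ∘ P` nor `R ∘ R`, then `P` is an involution. -/
lemma eventually_involutive_of_frequently {P R : ℝ → ℝ} (hP : ContDiffAt ℝ ω P 0)
    (hR : ContDiffAt ℝ ω R 0) (hP0 : P 0 = 0) (hR0 : R 0 = 0)
    (hRP : ∀ᶠ s in 𝓝 0, R (P s) = s) (hPR : ∀ᶠ s in 𝓝 0, P (R s) = s)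
    (h : ∃ᶠ m in 𝓝[>] (0 : ℝ), (0 < P (P m) → m ≤ P (P m)) ∧ (0 < R (R m) → m ≤ R (R m))) :
    ∀ᶠ s in 𝓝 0, P (P s) = s := by
  have hω : (ω : ℕ∞ω) ≠ 0 := by simp
  have hPd := (hP.differentiableAt hω).hasDerivAt
  have hRd := (hR.differentiableAt hω).hasDerivAt
  set a := deriv P 0
  set b := deriv R 0
  have hab : b * a = 1 := by
    have h1 : HasDerivAt (R ∘ P) (b * a) 0 := HasDerivAt.comp 0 (by rwa [hP0]) hPd
    exact h1.unique ((hasDerivAt_id 0).congr_of_eventuallyEq hRP)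
  have ha : a ≠ 0 := right_ne_zero_of_mul_eq_one hab
  have hb : b ≠ 0 := left_ne_zero_of_mul_eq_one hab
  have hPP : ContDiffAt ℝ ω (P ∘ P) 0 := ContDiffAt.comp 0 (by rwa [hP0]) hP
  have hRR : ContDiffAt ℝ ω (R ∘ R) 0 := ContDiffAt.comp 0 (by rwa [hR0]) hR
  obtain ⟨ε, hε, hPmono⟩ := (hPP.of_le le_top).exists_strictMonoOn_ball
    (HasDerivAt.comp 0 (by rwa [hP0]) hPd) (mul_self_pos.2 ha)
  obtain ⟨δ, hδ, hRmono⟩ := (hRR.of_le le_top).exists_strictMonoOn_ball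
    (HasDerivAt.comp 0 (by rwa [hR0]) hRd) (mul_self_pos.2 hb)
  have han : AnalyticAt ℝ (fun s ↦ P (P s) - s) 0 :=
    hPP.analyticAt.sub analyticAt_id
  rcases han.eventually_eq_zero_or_eventually_ne_zero with h0 | h0
  · filter_upwards [h0] with s hs using sub_eq_zero.1 hs
  exfalso
  have hRt : Tendsto R (𝓝 0) (𝓝 0) := by simpa [hR0] using hR.continuousAt.tendsto
  have hRRt : Tendsto (fun s ↦ R (R s)) (𝓝 0) (𝓝 0) := hRt.comp hRt
  have hev : ∀ᶠ m in 𝓝 (0 : ℝ), P (P (R (R m))) = m ∧ m ∈ Metric.ball (0 : ℝ) ε ∧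
      R (R m) ∈ Metric.ball (0 : ℝ) ε ∧ m ∈ Metric.ball (0 : ℝ) δ := by
    filter_upwards [hPR, hRt.eventually hPR, Metric.ball_mem_nhds 0 hε,
      hRRt (Metric.ball_mem_nhds 0 hε), Metric.ball_mem_nhds 0 hδ] with m h1 h2 h3 h4 h5
    exact ⟨by rw [h2, h1], h3, h4, h5⟩
  obtain ⟨m, ⟨⟨⟨hm1, hm2⟩, hm3, hm4, hm5, hm6⟩, hm7⟩, hm8⟩ :=
    ((h.and_eventually (hev.filter_mono nhdsWithin_le_nhds)).and_eventually
      (h0.filter_mono (nhdsWithin_mono 0 fun x hx ↦ ne_of_gt hx))).and_eventually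
      self_mem_nhdsWithin |>.exists
  have hm8 : 0 < m := hm8
  have p1 : 0 < P (P m) := by
    simpa [hP0] using hPmono (Metric.mem_ball_self hε) hm4 hm8
  have p2 : 0 < R (R m) := by
    simpa [hR0] using hRmono (Metric.mem_ball_self hδ) hm6 hm8
  have p3 := hPmono.monotoneOn hm4 hm5 (hm2 p2)
  simp only [Function.comp_apply, hm3] at p3
  exact hm7 (by linarith [hm1 p1])

section PeriodicOrbits

variable {X : ℝ × ℝ → ℝ × ℝ} {γ : ℝ → ℝ × ℝ} {v : ℝ × ℝ}

/-- `γ` is a periodic global solution (possibly constant) of the vector field `X`. -/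
def IsPeriodicCurve (X : ℝ × ℝ → ℝ × ℝ) (γ : ℝ → ℝ × ℝ) : Prop :=
  (∀ t, HasDerivAt γ (X (γ t)) t) ∧ ∃ T > 0, ∀ t, γ (t + T) = γ t

lemma IsPeriodicCurve.shift (h : IsPeriodicCurve X γ) (s : ℝ) :
    IsPeriodicCurve X fun t ↦ γ (s + t) := by
  obtain ⟨hγ, T, hT, hper⟩ := h
  exact ⟨fun t ↦ (hγ (s + t)).comp_const_add s t, T, hT, fun t ↦ by simp [← add_assoc, hper]⟩

lemma IsPeriodicCurve.isCompact_range (h : IsPeriodicCurve X γ) : IsCompact (range γ) := by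
  obtain ⟨hγ, T, hT, hper⟩ := h
  exact Function.Periodic.compact_of_continuous hper hT.ne'
    (continuous_iff_continuousAt.2 fun t ↦ (hγ t).continuousAt)

lemma IsPeriodicCurve.mem_range_of_reach (hX : ContDiff ℝ 1 X) (h : IsPeriodicCurve X γ) {T : ℝ}
    {z w : ℝ × ℝ} (hz : z ∈ range γ) (hzw : Reach X T z w) : w ∈ range γ := by
  obtain ⟨s, rfl⟩ := hz
  exact ⟨_, (hzw.eq_of_hasDerivAt hX h.1).symm⟩

lemma tendsto_smul_line (p v : ℝ × ℝ) : Tendsto (fun s : ℝ ↦ p + s • v) (𝓝 0) (𝓝 p) := by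
  have : Continuous fun s : ℝ ↦ p + s • v := by fun_prop
  simpa using this.tendsto 0

/-- Near a point of a closed orbit, points project along the flow to an orthogonal section, which
points of the section cannot meet again after a short time, and the return maps to the section
after any (positive or negative) multiple of the period are analytic. -/
lemma exists_analytic_return_map
    (hX : ∃ p q : MvPolynomial (Fin 2) ℝ, ∀ z : ℝ × ℝ,
      X z = (MvPolynomial.eval ![z.1, z.2] p, MvPolynomial.eval ![z.1, z.2] q))
    (hγ : ∀ t, HasDerivAt γ (X (γ t)) t) (h0 : X (γ 0) ≠ 0) (hv : v ≠ 0)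
    (hvX : v.1 * (X (γ 0)).1 + v.2 * (X (γ 0)).2 = 0) :
    ∃ σ c : ℝ × ℝ → ℝ, ContinuousAt c (γ 0) ∧ c (γ 0) = 0 ∧
      (∀ᶠ z in 𝓝 (γ 0), Reach X (σ z) z (γ 0 + c z • v)) ∧
      (∀ᶠ x in 𝓝 ((0 : ℝ), γ 0), x.2 - γ 0 ∈ Submodule.span ℝ {v} → ∀ s : ℝ,
        Reach X x.1 x.2 (γ 0 + s • v) → x.1 = 0) ∧
      ∀ T, γ T = γ 0 → ∃ P τ : ℝ → ℝ, ContDiffAt ℝ ω P 0 ∧ P 0 = 0 ∧ ContinuousAt τ 0 ∧ τ 0 = T ∧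
        ∀ᶠ s in 𝓝 0, Reach X (τ s) (γ 0 + s • v) (γ 0 + P s • v) := by
  have hXc : ContDiff ℝ 1 X := by
    obtain ⟨p, q, hX⟩ := hX
    exact contDiff_of_polynomial hX
  obtain ⟨σ, c, hσ, hσ0, hc, hc0, hr, hu⟩ := exists_analytic_projection hX hγ h0 hv hvX
  refine ⟨σ, c, hc.continuousAt, hc0, hr, hu, fun T hT ↦ ?_⟩
  obtain ⟨G, hG, hGr⟩ := exists_analytic_time_map hX hγ T
  have hG0 : G (γ 0) = γ 0 := by
    simpa [hT] using hGr.self_of_nhds.eq_of_hasDerivAt hXc hγ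
  set p := γ 0
  have hL : ContDiffAt ℝ ω (fun s : ℝ ↦ p + s • v) 0 :=
    contDiffAt_const.add (contDiffAt_id.smul contDiffAt_const)
  have hp0 : p + (0 : ℝ) • v = p := by simp
  have hGL : ContDiffAt ℝ ω (fun s : ℝ ↦ G (p + s • v)) 0 :=
    ContDiffAt.comp (g := G) 0 (by rwa [hp0]) hL
  have hGLt : Tendsto (fun s : ℝ ↦ G (p + s • v)) (𝓝 0) (𝓝 p) := by
    simpa [hG0] using hGL.continuousAt.tendsto
  refine ⟨fun s ↦ c (G (p + s • v)), fun s ↦ T + σ (G (p + s • v)), ?_, by simp [hG0, hc0], ?_,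
    by simp [hG0, hσ0], ?_⟩
  · exact ContDiffAt.comp (g := c) (f := fun s : ℝ ↦ G (p + s • v)) 0
      (by simpa [hG0] using hc) hGL
  · refine continuousAt_const.add ?_
    exact ContinuousAt.comp (g := σ) (f := fun s : ℝ ↦ G (p + s • v))
      (by simpa [hG0] using hσ.continuousAt) hGL.continuousAt
  · filter_upwards [(tendsto_smul_line p v).eventually hGr, hGLt.eventually hr] with s h1 h2
    exact h1.trans hXc h2

/-- If closed orbits distinct from the closed orbit `γ` accumulate at `γ 0` along one side of a
section, then all points close to `γ 0` lie on closed orbits. -/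
lemma IsPeriodicCurve.eventually_periodic
    (hX : ∃ p q : MvPolynomial (Fin 2) ℝ, ∀ z : ℝ × ℝ,
      X z = (MvPolynomial.eval ![z.1, z.2] p, MvPolynomial.eval ![z.1, z.2] q))
    (hγ : IsPeriodicCurve X γ) (h0 : X (γ 0) ≠ 0) (hv : v ≠ 0)
    (hvX : v.1 * (X (γ 0)).1 + v.2 * (X (γ 0)).2 = 0)
    (hfr : ∃ᶠ s in 𝓝[>] (0 : ℝ), ∃ η, IsPeriodicCurve X η ∧ η 0 = γ 0 + s • v ∧ γ 0 ∉ range η) :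
    ∀ᶠ z in 𝓝 (γ 0), ∃ η, IsPeriodicCurve X η ∧ η 0 = z := by
  have hXc : ContDiff ℝ 1 X := by
    obtain ⟨p, q, hX⟩ := hX
    exact contDiff_of_polynomial hX
  obtain ⟨hγ, T, hT, hper⟩ := hγ
  obtain ⟨σ, c, hc, hc0, hr, hu, hret⟩ := exists_analytic_return_map hX hγ h0 hv hvX
  have hT1 : γ T = γ 0 := by simpa using hper 0
  have hT2 : γ (-T) = γ 0 := by simpa using (hper (-T)).symm
  obtain ⟨P, τ, hP, hP0, hτ, hτ0, hPr⟩ := hret T hT1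
  obtain ⟨R, ρ, hR, hR0, hρ, hρ0, hRr⟩ := hret (-T) hT2
  set p := γ 0
  have hline : ∀ s : ℝ, p + s • v - p ∈ Submodule.span ℝ {v} := fun s ↦ by
    simpa using Submodule.smul_mem _ s (Submodule.mem_span_singleton_self v)
  have inv : ∀ {P R τ ρ : ℝ → ℝ}, ContinuousAt P 0 → P 0 = 0 → ContinuousAt τ 0 →
      ContinuousAt ρ 0 → τ 0 + ρ 0 = 0 →
      (∀ᶠ s in 𝓝 0, Reach X (τ s) (p + s • v) (p + P s • v)) →
      (∀ᶠ s in 𝓝 0, Reach X (ρ s) (p + s • v) (p + R s • v)) → ∀ᶠ s in 𝓝 0, R (P s) = s := by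
    intro P R τ ρ hP hP0 hτ hρ hτρ hPr hRr
    have hPt : Tendsto P (𝓝 0) (𝓝 0) := by simpa [hP0] using hP.tendsto
    have hρt : Tendsto ρ (𝓝 0) (𝓝 (ρ 0)) := hρ.tendsto
    have ht : Tendsto (fun s ↦ τ s + ρ (P s)) (𝓝 0) (𝓝 0) := by
      simpa [hτρ] using hτ.tendsto.add (hρt.comp hPt)
    filter_upwards [hPr, hPt.eventually hRr,
      (ht.prodMk_nhds (tendsto_smul_line p v)).eventually hu] with s h1 h2 h3
    have h12 := h1.trans hXc h2
    rw [h3 (hline s) _ h12] at h12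
    exact smul_left_injective ℝ hv (add_left_cancel (h12.unique hXc (Reach.zero hXc _)))
  have hRP := inv hP.continuousAt hP0 hτ hρ (by rw [hτ0, hρ0]; ring) hPr hRr
  have hPR := inv hR.continuousAt hR0 hρ hτ (by rw [hτ0, hρ0]; ring) hRr hPr
  have hPt : Tendsto P (𝓝 0) (𝓝 0) := by simpa [hP0] using hP.continuousAt.tendsto
  have hRt : Tendsto R (𝓝 0) (𝓝 0) := by simpa [hR0] using hR.continuousAt.tendsto
  have hmin : ∃ᶠ m in 𝓝[>] (0 : ℝ), ∃ η, IsPeriodicCurve X η ∧ p + m • v ∈ range η ∧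
      ∀ r, 0 < r → p + r • v ∈ range η → m ≤ r := by
    rw [(nhdsGT_basis (0 : ℝ)).frequently_iff] at hfr ⊢
    intro ε hε
    obtain ⟨s, hs, η, hη, hηs, hpη⟩ := hfr ε hε
    have hK : IsCompact (Icc 0 s ∩ {r : ℝ | p + r • v ∈ range η}) :=
      isCompact_Icc.inter_right
        (hη.isCompact_range.isClosed.preimage (by fun_prop : Continuous fun r : ℝ ↦ p + r • v))
    obtain ⟨m, hm, hmin⟩ := hK.exists_isLeast ⟨s, ⟨hs.1.le, le_rfl⟩, 0, hηs⟩
    refine ⟨m, ⟨hm.1.1.lt_of_ne ?_, hm.1.2.trans_lt hs.2⟩, η, hη, hm.2, fun r hr hrη ↦ ?_⟩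
    · rintro rfl
      exact hpη (by simpa using hm.2)
    · by_contra! hrm
      exact hrm.not_ge (hmin ⟨⟨hr.le, hrm.le.trans hm.1.2⟩, hrη⟩)
  have hPP : ∀ᶠ s in 𝓝 0, P (P s) = s := by
    refine eventually_involutive_of_frequently hP hR hP0 hR0 hRP hPR ?_
    have hev := ((hPr.and (hPt.eventually hPr)).and (hRr.and (hRt.eventually hRr))).filter_mono
      (nhdsWithin_le_nhds (s := Ioi 0))
    refine (hmin.and_eventually hev).mono ?_
    rintro m ⟨⟨η, hη, hm, hle⟩, ⟨h1, h2⟩, h3, h4⟩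
    have hη' : ∀ {T z w}, z ∈ range η → Reach X T z w → w ∈ range η :=
      fun hz hzw ↦ hη.mem_range_of_reach hXc hz hzw
    exact ⟨fun h ↦ hle _ h (hη' (hη' hm h1) h2), fun h ↦ hle _ h (hη' (hη' hm h3) h4)⟩
  have hper' : ∀ᶠ s in 𝓝 (0 : ℝ), ∃ η, IsPeriodicCurve X η ∧ η 0 = p + s • v := by
    have hτt : Tendsto τ (𝓝 0) (𝓝 T) := hτ0 ▸ hτ.tendsto
    have ht : Tendsto (fun s ↦ τ s + τ (P s)) (𝓝 0) (𝓝 (T + T)) := hτt.add (hτt.comp hPt)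
    filter_upwards [hPr, hPt.eventually hPr, hPP, ht.eventually_ne (by positivity : T + T ≠ 0)]
      with s h1 h2 h3 h4
    rw [h3] at h2
    obtain ⟨η, hη, hηT, hη0⟩ := (h1.trans hXc h2).exists_periodic hXc h4
    exact ⟨η, ⟨hη, hηT⟩, hη0⟩
  have hct : Tendsto c (𝓝 p) (𝓝 0) := by simpa [hc0] using hc.tendsto
  filter_upwards [hr, hct.eventually hper'] with z h1 h2
  obtain ⟨η, hη, hη0⟩ := h2
  obtain ⟨t, rfl⟩ := hη.mem_range_of_reach hXc ⟨0, hη0⟩ h1.symm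
  exact ⟨_, hη.shift t, by simp⟩

/-- If closed orbits distinct from the closed orbit `γ` accumulate at `γ 0`, then all points close
to `γ 0` lie on closed orbits. -/
lemma IsPeriodicCurve.eventually_periodic_of_frequently
    (hX : ∃ p q : MvPolynomial (Fin 2) ℝ, ∀ z : ℝ × ℝ,
      X z = (MvPolynomial.eval ![z.1, z.2] p, MvPolynomial.eval ![z.1, z.2] q))
    (hγ : IsPeriodicCurve X γ) (h0 : X (γ 0) ≠ 0)
    (hfr : ∃ᶠ z in 𝓝 (γ 0), ∃ η, IsPeriodicCurve X η ∧ η 0 = z ∧ γ 0 ∉ range η) :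
    ∀ᶠ z in 𝓝 (γ 0), ∃ η, IsPeriodicCurve X η ∧ η 0 = z := by
  have hXc : ContDiff ℝ 1 X := by
    obtain ⟨p, q, hX⟩ := hX
    exact contDiff_of_polynomial hX
  set v : ℝ × ℝ := (-(X (γ 0)).2, (X (γ 0)).1) with hvdef
  have hv : v ≠ 0 := fun h ↦ h0 (by
    simp only [hvdef, Prod.mk_eq_zero, neg_eq_zero] at h
    exact Prod.ext h.2 h.1)
  have hvX : v.1 * (X (γ 0)).1 + v.2 * (X (γ 0)).2 = 0 := by simp only [hvdef]; ring
  obtain ⟨σ, c, hc, hc0, hr, -, -⟩ := exists_analytic_return_map hX hγ.1 h0 hv hvX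
  have hct : Tendsto c (𝓝 (γ 0)) (𝓝 0) := by simpa [hc0] using hc.tendsto
  have hline : ∃ᶠ s in 𝓝 (0 : ℝ), s ≠ 0 ∧
      ∃ η, IsPeriodicCurve X η ∧ η 0 = γ 0 + s • v ∧ γ 0 ∉ range η := by
    refine hct.frequently ((hfr.and_eventually hr).mono ?_)
    rintro z ⟨⟨η, hη, hηz, hpη⟩, hz⟩
    obtain ⟨t, ht⟩ := hη.mem_range_of_reach hXc ⟨0, hηz⟩ hz
    refine ⟨fun h ↦ hpη ⟨t, by simpa [h] using ht⟩, _, hη.shift t, by simpa using ht, ?_⟩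
    rintro ⟨s, hs⟩
    exact hpη ⟨_, hs⟩
  have hne : ∃ᶠ s in 𝓝[<] (0 : ℝ) ⊔ 𝓝[>] 0,
      ∃ η, IsPeriodicCurve X η ∧ η 0 = γ 0 + s • v ∧ γ 0 ∉ range η := by
    rw [nhdsLT_sup_nhdsGT, frequently_nhdsWithin_iff]
    exact hline.mono fun s hs ↦ ⟨hs.2, hs.1⟩
  rcases frequently_sup.1 hne with h | h
  · refine hγ.eventually_periodic hX h0 (neg_ne_zero.2 hv)
      (by simp only [Prod.fst_neg, Prod.snd_neg]; linarith) ?_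
    have hneg : Tendsto (fun s : ℝ ↦ -s) (𝓝[<] 0) (𝓝[>] 0) := by
      simpa using tendsto_neg_nhdsLT (a := (0 : ℝ))
    exact hneg.frequently (h.mono fun s hs ↦ by simpa using hs)
  · exact hγ.eventually_periodic hX h0 hv hvX h

/-- The union of the closed orbits through an open set `B` consisting of points on closed orbits
is open. -/
lemma isOpen_union_periodic_orbits
    (hX : ∃ p q : MvPolynomial (Fin 2) ℝ, ∀ z : ℝ × ℝ,
      X z = (MvPolynomial.eval ![z.1, z.2] p, MvPolynomial.eval ![z.1, z.2] q))
    {B : Set (ℝ × ℝ)} (hB : IsOpen B) (hBp : ∀ z ∈ B, ∃ η, IsPeriodicCurve X η ∧ η 0 = z) :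
    IsOpen (⋃ (η) (_ : IsPeriodicCurve X η ∧ η 0 ∈ B), range η) := by
  have hXc : ContDiff ℝ 1 X := by
    obtain ⟨p, q, hX⟩ := hX
    exact contDiff_of_polynomial hX
  refine isOpen_iff_mem_nhds.2 fun z hz ↦ ?_
  simp only [mem_iUnion] at hz
  obtain ⟨η, ⟨hη, hηB⟩, t, rfl⟩ := hz
  have hs := hη.shift t
  obtain ⟨G, hG, hGr⟩ := exists_analytic_time_map hX hs.1 (-t)
  have hG0 : G (η (t + 0)) = η 0 := by
    simpa using hGr.self_of_nhds.eq_of_hasDerivAt hXc hs.1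
  have hGB : ∀ᶠ z in 𝓝 (η (t + 0)), G z ∈ B :=
    hG.continuousAt (hB.mem_nhds (by simpa only [hG0] using hηB))
  rw [add_zero] at hGr hGB
  filter_upwards [hGr, hGB] with z h1 h2
  obtain ⟨ζ, hζ, hζ0⟩ := hBp _ h2
  exact mem_iUnion₂.2 ⟨ζ, ⟨hζ, hζ0 ▸ h2⟩, hζ.mem_range_of_reach hXc ⟨0, hζ0⟩ h1.symm⟩

/-- The union of the closed orbits through a connected set `B` consisting of points on closed
orbits is connected. -/
lemma isPreconnected_union_periodic_orbits {B : Set (ℝ × ℝ)} (hB : IsPreconnected B)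
    (hBp : ∀ z ∈ B, ∃ η, IsPeriodicCurve X η ∧ η 0 = z) :
    IsPreconnected (⋃ (η) (_ : IsPeriodicCurve X η ∧ η 0 ∈ B), range η) := by
  rcases B.eq_empty_or_nonempty with rfl | ⟨b, hb⟩
  · simpa using isPreconnected_empty
  refine isPreconnected_of_forall b fun z hz ↦ ?_
  obtain ⟨η, ⟨hη, hηB⟩, t, rfl⟩ := mem_iUnion₂.1 hz
  refine ⟨B ∪ range η, union_subset (fun y hy ↦ ?_) fun y hy ↦ mem_iUnion₂.2 ⟨η, ⟨hη, hηB⟩, hy⟩,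
    .inl hb, .inr ⟨t, rfl⟩, ?_⟩
  · obtain ⟨ζ, hζ, rfl⟩ := hBp y hy
    exact mem_iUnion₂.2 ⟨ζ, ⟨hζ, hy⟩, 0, rfl⟩
  · exact hB.union (η 0) hηB ⟨0, rfl⟩ (isPreconnected_range
      (continuous_iff_continuousAt.2 fun t ↦ (hη.1 t).continuousAt))

lemma eq_const_of_hasDerivAt (hX : ContDiff ℝ 1 X) (hγ : ∀ t, HasDerivAt γ (X (γ t)) t) {s : ℝ}
    (hs : X (γ s) = 0) (t : ℝ) : γ t = γ s := by
  have h : Reach X (t - s) (γ s) (γ s) :=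
    .of_hasDerivAt (γ := fun _ ↦ γ s) (fun r ↦ by simpa [hs] using hasDerivAt_const r (γ s)) 0 _
  simpa using (h.eq_of_hasDerivAt hX hγ).symm

lemma IsPeriodicCurve.isPeriodicSolOn (h : IsPeriodicCurve X γ) {s : ℝ} (hs : X (γ s) ≠ 0)
    {S : Set (ℝ × ℝ)} (hS : range γ ⊆ S) : IsPeriodicSolOn X S γ := by
  refine ⟨fun t ↦ hS ⟨t, rfl⟩, h.1, h.2, ?_⟩
  by_contra! hc
  have h1 : HasDerivAt γ 0 s := by
    rw [show γ = fun _ ↦ γ s from funext fun t ↦ hc t s]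
    exact hasDerivAt_const s (γ s)
  exact hs ((h.1 s).unique h1)

end PeriodicOrbits

theorem frontier_of_period_annulus_is_not_periodic_orbit (X : ℝ × ℝ → ℝ × ℝ)
    (hX : ∃ p q : MvPolynomial (Fin 2) ℝ, ∀ z : ℝ × ℝ,
      X z = (MvPolynomial.eval ![z.1, z.2] p, MvPolynomial.eval ![z.1, z.2] q))
    (z₀ : ℝ × ℝ) (hz₀ : X z₀ = (0, 0))
    (W : Set (ℝ × ℝ)) (hW : IsPeriodAnnulus X Set.univ z₀ W) :
    ¬∃ γ, IsPeriodicSolOn X Set.univ γ ∧ Set.range γ = frontier W := by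
  rintro ⟨γ, ⟨-, hγ, hγp, t₁, t₂, hne⟩, hfr⟩
  have hXc : ContDiff ℝ 1 X := by
    obtain ⟨p, q, hX⟩ := hX
    exact contDiff_of_polynomial hX
  have hγ : IsPeriodicCurve X γ := ⟨hγ, hγp⟩
  obtain ⟨hz₀W, -, hWo, hWc, hWp, hmax⟩ := hW
  have h0 : X (γ 0) ≠ 0 := fun h ↦ hne <| by
    rw [eq_const_of_hasDerivAt hXc hγ.1 h t₁, eq_const_of_hasDerivAt hXc hγ.1 h t₂]
  have hpfr : γ 0 ∈ closure W \ W := by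
    rw [← hWo.frontier_eq, ← hfr]
    exact ⟨0, rfl⟩
  have hX0 : ∀ᶠ z in 𝓝 (γ 0), X z ≠ 0 := hXc.continuous.continuousAt.eventually_ne h0
  have hper : ∀ᶠ z in 𝓝 (γ 0), ∃ η, IsPeriodicCurve X η ∧ η 0 = z := by
    refine hγ.eventually_periodic_of_frequently hX h0 ?_
    refine ((mem_closure_iff_frequently.1 hpfr.1).and_eventually hX0).mono ?_
    rintro z ⟨hzW, hz⟩
    obtain ⟨η, hη, hηz⟩ := hWp z ⟨hzW, by rintro rfl; exact hz hz₀⟩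
    refine ⟨η, ⟨hη.2.1, hη.2.2.1⟩, hηz, ?_⟩
    rintro ⟨t, ht⟩
    exact hpfr.2 (ht ▸ hη.1 t)
  obtain ⟨ε, hε, hB⟩ := Metric.eventually_nhds_iff_ball.1 (hX0.and hper)
  set B := Metric.ball (γ 0) ε
  have hBp : ∀ z ∈ B, ∃ η, IsPeriodicCurve X η ∧ η 0 = z := fun z hz ↦ (hB z hz).2
  set A := ⋃ (η) (_ : IsPeriodicCurve X η ∧ η 0 ∈ B), range η
  have hBA : B ⊆ A := fun z hz ↦ by
    obtain ⟨η, hη, rfl⟩ := hBp z hz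
    exact mem_iUnion₂.2 ⟨η, ⟨hη, hz⟩, 0, rfl⟩
  have hpB : γ 0 ∈ B := Metric.mem_ball_self hε
  obtain ⟨y, hyB, hyW⟩ := mem_closure_iff.1 hpfr.1 B Metric.isOpen_ball hpB
  refine hpfr.2 ?_
  rw [← hmax (W ∪ A) (.inl hz₀W) (subset_univ _)
    (hWo.union (isOpen_union_periodic_orbits hX Metric.isOpen_ball hBp))
    ⟨⟨z₀, .inl hz₀W⟩, hWc.isPreconnected.union y hyW (hBA hyB)
      (isPreconnected_union_periodic_orbits (convex_ball _ _).isPreconnected hBp)⟩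
    ?_ subset_union_left]
  · exact .inr (hBA hpB)
  · rintro z ⟨hz | hz, hzz⟩
    · obtain ⟨η, hη, hηz⟩ := hWp z ⟨hz, hzz⟩
      exact ⟨η, ⟨fun t ↦ .inl (hη.1 t), hη.2⟩, hηz⟩
    · obtain ⟨η, hη, t, rfl⟩ := mem_iUnion₂.1 hz
      have hηA : range η ⊆ A := subset_iUnion₂_of_subset η hη subset_rfl
      refine ⟨_, (hη.1.shift t).isPeriodicSolOn (s := -t) (by simpa using (hB _ hη.2).1) ?_,
        by simp⟩
      rintro _ ⟨s, rfl⟩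
      exact .inr (hηA ⟨_, rfl⟩)
end

section
/- Let f : ℝ² → ℝ² be defined by f(x,y) = (e^x − 1, y), so that H_f(x,y) = ((e^x − 1)² + y²)/2, and let P = {(x,y) ∈ ℝ² : y² < e^x(2 − e^x)}. Then every point of P \ {(0,0)} lies on a periodic solution of ∇H_f^⊥ whose image is contained in P, and no point (x,y) with y² ≥ e^x(2 − e^x) lies on any periodic solution of ∇H_f^⊥; i.e., P is the period annulus of the center (0,0). -/
open Real Set

/-- The Hamiltonian vector field of `(x, y) ↦ (exp x - 1, y)`. -/
lemma hamVF_exp {f : ℝ × ℝ → ℝ × ℝ} (hf : ∀ x y : ℝ, f (x, y) = (Real.exp x - 1, y))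
    (z : ℝ × ℝ) : hamVF f z = (-z.2, (Real.exp z.1 - 1) * Real.exp z.1) := by
  have hHam : Ham f = fun w : ℝ × ℝ => ((Real.exp w.1 - 1) ^ 2 + w.2 ^ 2) / 2 := by
    funext w
    simp [Ham, hf w.1 w.2]
  have h1 : HasFDerivAt (fun w : ℝ × ℝ => w.1) (ContinuousLinearMap.fst ℝ ℝ ℝ) z :=
    hasFDerivAt_fst
  have h2 : HasFDerivAt (fun w : ℝ × ℝ => w.2) (ContinuousLinearMap.snd ℝ ℝ ℝ) z :=
    hasFDerivAt_snd
  have hu : HasFDerivAt (fun w : ℝ × ℝ => Real.exp w.1 - 1) _ z := h1.exp.sub_const 1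
  have hd := ((HasFDerivAt.pow hu 2).fun_add (HasFDerivAt.pow h2 2)).mul_const (1 / 2 : ℝ)
  simp only [mul_one_div, ← hHam] at hd
  simp only [hamVF, pdx, pdy, hd.fderiv]
  ext
  · simp
  · simp
    ring

/-- The substitution `w = exp (-x)` linearizes the Hamiltonian system: a positive solution of
the linear system `dw/dt = v`, `dv/dt = 1 - q w` on the level `-1` of its first integral
`v ^ 2 + q w ^ 2 - 2 w` gives the solution `(-log w, v / w)`. -/
lemma hasDerivAt_of_linear {w v : ℝ → ℝ} {q : ℝ} (hw : ∀ t, HasDerivAt w (v t) t)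
    (hv : ∀ t, HasDerivAt v (1 - q * w t) t)
    (hE : ∀ t, v t ^ 2 + q * w t ^ 2 - 2 * w t = -1) (hpos : ∀ t, 0 < w t) (t : ℝ) :
    HasDerivAt (fun s => (-Real.log (w s), v s / w s))
      (-(v t / w t), (Real.exp (-Real.log (w t)) - 1) * Real.exp (-Real.log (w t))) t := by
  have hne := (hpos t).ne'
  refine HasDerivAt.prodMk ((hw t).log hne).neg ?_
  refine ((hv t).div (hw t) hne).congr_deriv ?_
  rw [Real.exp_neg, Real.exp_log (hpos t)]
  field_simp
  linear_combination -hE t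

lemma exists_linear_solution {q w₀ v₀ : ℝ} (hq : 0 < q)
    (hE : v₀ ^ 2 + q * w₀ ^ 2 - 2 * w₀ = -1) :
    ∃ w v : ℝ → ℝ, w 0 = w₀ ∧ v 0 = v₀ ∧ (∀ t, HasDerivAt w (v t) t) ∧
      (∀ t, HasDerivAt v (1 - q * w t) t) ∧
      (∀ t, v t ^ 2 + q * w t ^ 2 - 2 * w t = -1) ∧
      ∃ T > 0, ∀ t, w (t + T) = w t ∧ v (t + T) = v t := by
  obtain ⟨k, hk, rfl⟩ : ∃ k : ℝ, 0 < k ∧ q = k ^ 2 :=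
    ⟨√q, Real.sqrt_pos.2 hq, (Real.sq_sqrt hq.le).symm⟩
  have hk0 := hk.ne'
  have hlin (t : ℝ) : HasDerivAt (fun s => k * s) k t := by
    simpa using (hasDerivAt_id t).const_mul k
  refine ⟨fun t => 1 / k ^ 2 + ((w₀ - 1 / k ^ 2) * Real.cos (k * t) +
      v₀ / k * Real.sin (k * t)),
    fun t => v₀ * Real.cos (k * t) - k * (w₀ - 1 / k ^ 2) * Real.sin (k * t),
    by simp, by simp, fun t => ?_, fun t => ?_, fun t => ?_, 2 * π / k, by positivity,
    fun t => ?_⟩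
  · refine ((((hlin t).cos.const_mul _).add ((hlin t).sin.const_mul _)).const_add
      _).congr_deriv ?_
    field_simp
    ring
  · refine (((hlin t).cos.const_mul _).sub ((hlin t).sin.const_mul _)).congr_deriv ?_
    field_simp
    ring
  · have hsc := Real.sin_sq_add_cos_sq (k * t)
    field_simp
    linear_combination (k ^ 2 * v₀ ^ 2 + (k ^ 2 * w₀ - 1) ^ 2) * hsc + k ^ 2 * hE
  · have : k * (t + 2 * π / k) = k * t + 2 * π := by field_simp
    simp [this]

lemma exists_periodic_of_mem {f : ℝ × ℝ → ℝ × ℝ}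
    (hf : ∀ x y : ℝ, f (x, y) = (Real.exp x - 1, y)) {z : ℝ × ℝ}
    (hz : z.2 ^ 2 < Real.exp z.1 * (2 - Real.exp z.1)) (hz0 : z ≠ (0, 0)) :
    ∃ γ, IsPeriodicSolOn (hamVF f)
      {z : ℝ × ℝ | z.2 ^ 2 < Real.exp z.1 * (2 - Real.exp z.1)} γ ∧ γ 0 = z := by
  have he := (Real.exp_pos z.1).ne'
  have hq := sub_pos.2 hz
  obtain ⟨w, v, hw0, hv0, hw, hv, hE, T, hT, hper⟩ :=
    exists_linear_solution (w₀ := (Real.exp z.1)⁻¹) (v₀ := z.2 * (Real.exp z.1)⁻¹) hq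
      (by field_simp; ring)
  have hpos (t : ℝ) : 0 < w t := by
    nlinarith [hE t, sq_nonneg (v t), mul_nonneg hq.le (sq_nonneg (w t))]
  have hder := hasDerivAt_of_linear hw hv hE hpos
  have hinit : (fun s => (-Real.log (w s), v s / w s)) 0 = z := by
    ext <;> simp [hw0, hv0]
  refine ⟨fun s => (-Real.log (w s), v s / w s), ⟨fun t => ?_, fun t => ?_, ⟨T, hT, fun t => ?_⟩,
    ?_⟩, hinit⟩
  · have hne := (hpos t).ne'
    simp only [mem_ofPred_eq, Real.exp_neg, Real.exp_log (hpos t)]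
    have h : (w t)⁻¹ * (2 - (w t)⁻¹) - (v t / w t) ^ 2 =
        Real.exp z.1 * (2 - Real.exp z.1) - z.2 ^ 2 := by
      rw [← sub_eq_zero]
      field_simp
      linear_combination -hE t
    linarith
  · rw [hamVF_exp hf]
    exact hder t
  · simp [hper t]
  · by_contra! hconst
    have h0 := hder 0
    rw [show (fun s => (-Real.log (w s), v s / w s)) = fun _ => z from
      funext fun s => (hconst s 0).trans hinit] at h0
    have h := h0.unique (hasDerivAt_const 0 z)
    simp only [hw0, hv0, Real.log_inv, Real.log_exp, neg_neg, Prod.mk_eq_zero] at h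
    refine hz0 (Prod.ext ?_ ?_)
    · have := (mul_eq_zero.1 h.2).resolve_right he
      exact Real.exp_eq_one_iff _ |>.1 (sub_eq_zero.1 this)
    · have h1 := h.1
      field_simp at h1
      simpa using h1

lemma not_periodic_of_le {f : ℝ × ℝ → ℝ × ℝ}
    (hf : ∀ x y : ℝ, f (x, y) = (Real.exp x - 1, y)) {z : ℝ × ℝ}
    (hz : Real.exp z.1 * (2 - Real.exp z.1) ≤ z.2 ^ 2) :
    ¬∃ γ, IsPeriodicSolOn (hamVF f) Set.univ γ ∧ γ 0 = z := by
  rintro ⟨γ, ⟨-, hγ, ⟨T, hT, hper⟩, -⟩, rfl⟩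
  simp only [hamVF_exp hf] at hγ
  have h1 (t : ℝ) : HasDerivAt (fun s => (γ s).1) (-(γ t).2) t := (hγ t).fst
  have h2 (t : ℝ) : HasDerivAt (fun s => (γ s).2)
      ((Real.exp (γ t).1 - 1) * Real.exp (γ t).1) t := (hγ t).snd
  have hH (t : ℝ) : HasDerivAt (fun s => (Real.exp (γ s).1 - 1) ^ 2 + (γ s).2 ^ 2) 0 t := by
    refine ((((h1 t).exp.sub_const 1).pow 2).add ((h2 t).pow 2)).congr_deriv ?_
    ring
  have hconst (t : ℝ) := is_const_of_deriv_eq_zero (fun s => (hH s).differentiableAt)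
    (fun s => (hH s).deriv) t 0
  have hv (t : ℝ) : HasDerivAt (fun s => Real.exp (-(γ s).1) * (γ s).2)
      (Real.exp (-(γ t).1) * (Real.exp (γ t).1 * (Real.exp (γ t).1 - 1) + (γ t).2 ^ 2)) t := by
    refine ((h1 t).fun_neg.exp.mul (h2 t)).congr_deriv ?_
    ring
  have hmono : StrictMono fun s => Real.exp (-(γ s).1) * (γ s).2 := by
    refine strictMono_of_deriv_pos fun t => ?_
    rw [(hv t).deriv]
    have h := hconst t
    refine mul_pos (Real.exp_pos _) ?_
    nlinarith [Real.exp_pos (γ t).1]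
  have h := hmono hT
  have hp := hper 0
  rw [zero_add] at hp
  simp [hp] at h

lemma isOpen_annulus :
    IsOpen {z : ℝ × ℝ | z.2 ^ 2 < Real.exp z.1 * (2 - Real.exp z.1)} :=
  isOpen_lt (by fun_prop) (by fun_prop)

lemma isConnected_annulus :
    IsConnected {z : ℝ × ℝ | z.2 ^ 2 < Real.exp z.1 * (2 - Real.exp z.1)} := by
  have hstar : StarConvex ℝ 0 {p : ℝ × ℝ | p.1 ^ 2 + p.2 ^ 2 < 1} := by
    rw [starConvex_zero_iff]
    intro p hp a ha0 ha1
    simp only [mem_ofPred_eq, Prod.smul_fst, Prod.smul_snd, smul_eq_mul] at hp ⊢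
    nlinarith [mul_le_of_le_one_left (add_nonneg (sq_nonneg p.1) (sq_nonneg p.2))
      (pow_le_one₀ (n := 2) ha0 ha1)]
  have hpos {p : ℝ × ℝ} (hp : p.1 ^ 2 + p.2 ^ 2 < 1) : 0 < 1 + p.1 := by
    nlinarith [sq_nonneg p.2]
  have himage : {z : ℝ × ℝ | z.2 ^ 2 < Real.exp z.1 * (2 - Real.exp z.1)} =
      (fun p : ℝ × ℝ => (Real.log (1 + p.1), p.2)) '' {p : ℝ × ℝ | p.1 ^ 2 + p.2 ^ 2 < 1} := by
    ext z
    constructor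
    · intro hz
      refine ⟨(Real.exp z.1 - 1, z.2), ?_, by simp⟩
      simp only [mem_ofPred_eq] at hz ⊢
      linarith
    · rintro ⟨p, hp, rfl⟩
      simp only [mem_ofPred_eq, Real.exp_log (hpos hp)] at hp ⊢
      linarith
  rw [himage]
  refine (hstar.isPathConnected (by simp)).isConnected.image _ (ContinuousOn.prodMk ?_ (by fun_prop))
  exact ContinuousOn.log (by fun_prop) fun p hp => (hpos hp).ne'

theorem example_exp_period_annulus (f : ℝ × ℝ → ℝ × ℝ)
    (hf : ∀ x y : ℝ, f (x, y) = (Real.exp x - 1, y))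
    (P : Set (ℝ × ℝ))
    (hP : P = {z : ℝ × ℝ | z.2 ^ 2 < Real.exp z.1 * (2 - Real.exp z.1)}) :
    (∀ z ∈ P \ {((0 : ℝ), (0 : ℝ))},
        ∃ γ, IsPeriodicSolOn (hamVF f) P γ ∧ γ 0 = z) ∧
      (∀ z : ℝ × ℝ, Real.exp z.1 * (2 - Real.exp z.1) ≤ z.2 ^ 2 →
        ¬∃ γ, IsPeriodicSolOn (hamVF f) Set.univ γ ∧ γ 0 = z) ∧
      IsPeriodAnnulus (hamVF f) Set.univ ((0 : ℝ), (0 : ℝ)) P := by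
  subst hP
  have hin : ∀ z ∈ {z : ℝ × ℝ | z.2 ^ 2 < Real.exp z.1 * (2 - Real.exp z.1)} \ {((0 : ℝ), (0 : ℝ))},
      ∃ γ, IsPeriodicSolOn (hamVF f)
        {z : ℝ × ℝ | z.2 ^ 2 < Real.exp z.1 * (2 - Real.exp z.1)} γ ∧ γ 0 = z :=
    fun z hz => exists_periodic_of_mem hf hz.1 hz.2
  have h0 : ((0 : ℝ), (0 : ℝ)) ∈
      {z : ℝ × ℝ | z.2 ^ 2 < Real.exp z.1 * (2 - Real.exp z.1)} := by norm_num
  refine ⟨hin, fun z hz => not_periodic_of_le hf hz, h0, subset_univ _, isOpen_annulus,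
    isConnected_annulus, hin, fun W' _ _ _ _ hW' hsub => Subset.antisymm (fun z hz => ?_) hsub⟩
  by_contra hzP
  obtain ⟨γ, ⟨-, hγ⟩, hγ0⟩ := hW' z ⟨hz, fun h => hzP (h ▸ h0)⟩
  exact not_periodic_of_le hf (not_lt.1 hzP) ⟨γ, ⟨fun _ => mem_univ _, hγ⟩, hγ0⟩
end

section
/- Let f = (f₁, f₂) : ℝ² → ℝ² be defined by f₁(x,y) = x/√(1 + x²) and f₂(x,y) = (x² + (1 + x²)² y)/√(1 + x²). Then det Df(x,y) = 1 for all (x,y) ∈ ℝ², f is injective, and (0,0) is the only zero of f. -/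
open Real Set

/-- The derivative of `x / √(1 + x²)`, viewed as a function on the plane. -/
theorem hasFDerivAt_fst_div_sqrt_one_add_sq (z : ℝ × ℝ) :
    HasFDerivAt (fun w : ℝ × ℝ => w.1 / √(1 + w.1 ^ 2))
      ((1 / √(1 + z.1 ^ 2) * (1 / (1 + z.1 ^ 2))) • ContinuousLinearMap.fst ℝ ℝ ℝ) z := by
  have h := (Real.hasDerivAt_arctan z.1).sin.comp_hasFDerivAt z
    (hasFDerivAt_fst (𝕜 := ℝ) (p := z))
  simpa only [Function.comp_def, Real.sin_arctan, Real.cos_arctan] using h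

theorem div_sqrt_one_add_sq_injective :
    Function.Injective fun x : ℝ => x / √(1 + x ^ 2) := by
  intro a b h
  simp only [← Real.sin_arctan] at h
  exact Real.arctan_injective (Real.injOn_sin
    ⟨(Real.neg_pi_div_two_lt_arctan a).le, (Real.arctan_lt_pi_div_two a).le⟩
    ⟨(Real.neg_pi_div_two_lt_arctan b).le, (Real.arctan_lt_pi_div_two b).le⟩ h)

/-- A partial derivative in the `y` direction is the derivative of a slice. -/
theorem pdy_eq_deriv {g : ℝ × ℝ → ℝ} {x y : ℝ} (hg : DifferentiableAt ℝ g (x, y)) :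
    pdy g (x, y) = deriv (fun t => g (x, t)) y := by
  have h : HasDerivAt (fun t : ℝ => (x, t)) (0, 1) y :=
    (hasDerivAt_const y x).prodMk (hasDerivAt_id y)
  exact (hg.hasFDerivAt.comp_hasDerivAt y h).deriv.symm

theorem example_nonpolynomial_injective (f : ℝ × ℝ → ℝ × ℝ)
    (hf : ∀ x y : ℝ, f (x, y) =
      (x / Real.sqrt (1 + x ^ 2),
        (x ^ 2 + (1 + x ^ 2) ^ 2 * y) / Real.sqrt (1 + x ^ 2))) :
    (∀ z : ℝ × ℝ, jacDet f z = 1) ∧ Function.Injective f ∧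
      ∀ z : ℝ × ℝ, f z = (0, 0) ↔ z = ((0 : ℝ), (0 : ℝ)) := by
  have hf₁ : (fun w => (f w).1) = fun w => w.1 / √(1 + w.1 ^ 2) :=
    funext fun ⟨x, y⟩ => by simp [hf]
  have hf₂ : (fun w => (f w).2) =
      fun w => (w.1 ^ 2 + (1 + w.1 ^ 2) ^ 2 * w.2) / √(1 + w.1 ^ 2) :=
    funext fun ⟨x, y⟩ => by simp [hf]
  have hpos (x : ℝ) : 0 < 1 + x ^ 2 := by positivity
  have hinj : Function.Injective f := by
    rintro ⟨a, b⟩ ⟨c, d⟩ h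
    rw [hf, hf, Prod.mk.injEq] at h
    obtain ⟨h₁, h₂⟩ := h
    obtain rfl : a = c := div_sqrt_one_add_sq_injective h₁
    have h₃ := (div_left_inj' (Real.sqrt_pos.2 (hpos a)).ne').1 h₂
    rw [mul_right_injective₀ (pow_ne_zero 2 (hpos a).ne') (add_left_cancel h₃)]
  have hzero : f (0, 0) = (0, 0) := by simp [hf]
  refine ⟨?_, hinj, fun z => ⟨fun h => hinj (h.trans hzero.symm), fun h => h ▸ hzero⟩⟩
  rintro ⟨x, y⟩
  have hsq : √(1 + x ^ 2) ^ 2 = 1 + x ^ 2 := Real.sq_sqrt (hpos x).le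
  have hx₁ : pdx (fun w => (f w).1) (x, y) = 1 / √(1 + x ^ 2) * (1 / (1 + x ^ 2)) := by
    rw [hf₁, pdx, (hasFDerivAt_fst_div_sqrt_one_add_sq (x, y)).fderiv]
    simp
  have hy₁ : pdy (fun w => (f w).1) (x, y) = 0 := by
    rw [hf₁, pdy, (hasFDerivAt_fst_div_sqrt_one_add_sq (x, y)).fderiv]
    simp
  have hy₂ : pdy (fun w => (f w).2) (x, y) = (1 + x ^ 2) ^ 2 / √(1 + x ^ 2) := by
    have hd : DifferentiableAt ℝ (fun w : ℝ × ℝ =>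
        (w.1 ^ 2 + (1 + w.1 ^ 2) ^ 2 * w.2) / √(1 + w.1 ^ 2)) (x, y) := by
      fun_prop (disch := positivity)
    rw [hf₂, pdy_eq_deriv hd]
    simp
  rw [jacDet, hx₁, hy₁, hy₂, mul_zero, sub_zero]
  field_simp
  exact hsq.symm
end

section
/- Let f = (f₁, f₂) : ℝ² → ℝ² be defined by f₁(x,y) = x/√(1 + x²) and f₂(x,y) = (x² + (1 + x²)² y)/√(1 + x²). Then H_f(x,y) = (1 + x²)³ y²/2 + x²(1 + x²) y + x²/2 for all (x,y) ∈ ℝ², and the level set {(x,y) ∈ ℝ² : (1 + x²)³ y²/2 + x²(1 + x²) y + x²/2 = 1/2} is unbounded and not connected. -/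
open Real Set

/-- The level set `H = 1/2` is where the numerator of the second component is `±1`. -/
theorem level_eq_half_iff (x y : ℝ) :
    (1 + x ^ 2) ^ 3 * y ^ 2 / 2 + x ^ 2 * (1 + x ^ 2) * y + x ^ 2 / 2 = 1 / 2 ↔
      (x ^ 2 + (1 + x ^ 2) ^ 2 * y) ^ 2 = 1 := by
  have hs : 1 + x ^ 2 ≠ 0 := by positivity
  constructor
  · intro h
    linear_combination 2 * (1 + x ^ 2) * h
  · intro h
    apply mul_left_cancel₀ hs
    linear_combination h / 2

theorem example_polynomial_hamiltonian (f : ℝ × ℝ → ℝ × ℝ)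
    (hf : ∀ x y : ℝ, f (x, y) =
      (x / Real.sqrt (1 + x ^ 2),
        (x ^ 2 + (1 + x ^ 2) ^ 2 * y) / Real.sqrt (1 + x ^ 2))) :
    (∀ x y : ℝ, Ham f (x, y) =
        (1 + x ^ 2) ^ 3 * y ^ 2 / 2 + x ^ 2 * (1 + x ^ 2) * y + x ^ 2 / 2) ∧
      ¬Bornology.IsBounded {z : ℝ × ℝ |
        (1 + z.1 ^ 2) ^ 3 * z.2 ^ 2 / 2 + z.1 ^ 2 * (1 + z.1 ^ 2) * z.2
          + z.1 ^ 2 / 2 = 1 / 2} ∧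
      ¬IsPreconnected {z : ℝ × ℝ |
        (1 + z.1 ^ 2) ^ 3 * z.2 ^ 2 / 2 + z.1 ^ 2 * (1 + z.1 ^ 2) * z.2
          + z.1 ^ 2 / 2 = 1 / 2} := by
  refine ⟨fun x y => ?_, fun h => ?_, fun h => ?_⟩
  · have hs : 1 + x ^ 2 ≠ 0 := by positivity
    have hsq : Real.sqrt (1 + x ^ 2) ^ 2 = 1 + x ^ 2 := Real.sq_sqrt (by positivity)
    simp only [Ham, hf, div_pow, hsq]
    field_simp
    ring
  · obtain ⟨C, hC⟩ := h.exists_norm_le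
    have hmem := hC (|C| + 1, -1 / (1 + (|C| + 1) ^ 2)) <| by
      refine (level_eq_half_iff _ _).2 ?_
      have hs : 1 + (|C| + 1) ^ 2 ≠ 0 := by positivity
      field_simp
      ring
    have hle := (norm_fst_le _).trans hmem
    rw [Real.norm_eq_abs] at hle
    linarith [le_abs_self (|C| + 1), le_abs_self C]
  · have hcont : Continuous fun z : ℝ × ℝ => z.1 ^ 2 + (1 + z.1 ^ 2) ^ 2 * z.2 := by fun_prop
    obtain ⟨z, hz, hz0⟩ := h.intermediate_value (a := (0, -1)) (b := (0, 1))
      (by norm_num) (by norm_num) hcont.continuousOn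
      (show (0 : ℝ) ∈ Icc _ _ by norm_num)
    have hz1 := (level_eq_half_iff _ _).1 hz
    simp only at hz0
    rw [hz0] at hz1
    norm_num at hz1
end
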